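/- Let k be a field of characteristic p > 0, let n ≥ 1 and let G be a cyclic group of order p^n. Let A be a finitely generated kG-module equipped with a stable tt-ring structure (μ, u, σ). Then there exist a finitely generated kG-module B together with kG-linear maps μ_B: B ⊗ B → B, u_B: k → B and σ_B: B → B ⊗ B satisfying the identities μ_B∘(μ_B⊗id) = μ_B∘(id⊗μ_B), μ_B∘(u_B⊗id) = id = μ_B∘(id⊗u_B), μ_B∘τ = μ_B, μ_B∘σ_B = id, and (μ_B⊗id)∘(id⊗σ_B) = σ_B∘μ_B = (id⊗μ_B)∘(σ_B⊗id) exactly (not merely up to stably trivial maps), and a kG-linear map φ: B → A which is a stable isomorphism and for which φ∘μ_B − μ∘(φ⊗φ) and φ∘u_B − u are stably trivial. -/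

import Mathlib

open TensorProduct

section Defs

variable {k G : Type} [Field k] [Group G]

/-- A `kG`-linear map between two representations of `G` over `k`:
a `k`-linear map commuting with the `G`-actions. -/
def Equivariant {V W : Type} [AddCommGroup V] [Module k V] [AddCommGroup W] [Module k W]
    (ρV : Representation k G V) (ρW : Representation k G W) (f : V →ₗ[k] W) : Prop :=
  ∀ g : G, f ∘ₗ ρV g = ρW g ∘ₗ f

/-- A `kG`-linear map is stably trivial if it factors through a projective
`kG`-module (equivariantly). -/
def StablyTrivial {V W : Type} [AddCommGroup V] [Module k V] [AddCommGroup W] [Module k W]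
    (ρV : Representation k G V) (ρW : Representation k G W) (f : V →ₗ[k] W) : Prop :=
  ∃ (P : Type) (_ : AddCommGroup P) (_ : Module k P) (ρP : Representation k G P),
    Module.Projective (MonoidAlgebra k G) ρP.asModule ∧
    ∃ (a : V →ₗ[k] P) (b : P →ₗ[k] W),
      Equivariant ρV ρP a ∧ Equivariant ρP ρW b ∧ f = b ∘ₗ a

/-- A `kG`-linear map is a stable isomorphism if it is invertible up to
stably trivial maps. -/
def StableIso {V W : Type} [AddCommGroup V] [Module k V] [AddCommGroup W] [Module k W]
    (ρV : Representation k G V) (ρW : Representation k G W) (f : V →ₗ[k] W) : Prop :=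
  Equivariant ρV ρW f ∧ ∃ ψ : W →ₗ[k] V, Equivariant ρW ρV ψ ∧
    StablyTrivial ρV ρV (ψ ∘ₗ f - LinearMap.id) ∧
    StablyTrivial ρW ρW (f ∘ₗ ψ - LinearMap.id)

/-- A stable tt-ring structure on a `kG`-module `A`: a commutative, separable,
associative and unital multiplication, where all identities hold up to stably
trivial maps (i.e. in the stable module category). -/
structure StableTTRing {A : Type} [AddCommGroup A] [Module k A]
    (ρ : Representation k G A) where
  mul : A ⊗[k] A →ₗ[k] A
  one : k →ₗ[k] A
  sec : A →ₗ[k] A ⊗[k] A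
  mul_equivariant : Equivariant (ρ.tprod ρ) ρ mul
  one_equivariant : Equivariant (Representation.trivial k (G := G) (V := k)) ρ one
  sec_equivariant : Equivariant ρ (ρ.tprod ρ) sec
  assoc : StablyTrivial ((ρ.tprod ρ).tprod ρ) ρ
    (mul ∘ₗ mul.rTensor A -
      mul ∘ₗ mul.lTensor A ∘ₗ (TensorProduct.assoc k A A A).toLinearMap)
  one_mul : StablyTrivial ρ ρ
    (mul ∘ₗ one.rTensor A ∘ₗ (TensorProduct.lid k A).symm.toLinearMap - LinearMap.id)
  mul_one : StablyTrivial ρ ρ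
    (mul ∘ₗ one.lTensor A ∘ₗ (TensorProduct.rid k A).symm.toLinearMap - LinearMap.id)
  mul_comm : StablyTrivial (ρ.tprod ρ) ρ
    (mul ∘ₗ (TensorProduct.comm k A A).toLinearMap - mul)
  sep : StablyTrivial ρ ρ (mul ∘ₗ sec - LinearMap.id)
  sec_left : StablyTrivial (ρ.tprod ρ) (ρ.tprod ρ)
    (mul.rTensor A ∘ₗ (TensorProduct.assoc k A A A).symm.toLinearMap ∘ₗ sec.lTensor A
      - sec ∘ₗ mul)
  sec_right : StablyTrivial (ρ.tprod ρ) (ρ.tprod ρ)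
    (mul.lTensor A ∘ₗ (TensorProduct.assoc k A A A).toLinearMap ∘ₗ sec.rTensor A
      - sec ∘ₗ mul)

end Defs

section Auxiliary

open Finset

open Polynomial in
theorem Matrix.charpoly_pow_char_expand {K : Type*} [Field K] {ι : Type*} [DecidableEq ι] [Fintype ι]
    (p : ℕ) [Fact p.Prime] [CharP K p] (M : Matrix ι ι K) :
    expand K p (M ^ p).charpoly = M.charpoly ^ p := by
  cases (isEmpty_or_nonempty ι).symm
  · unfold charpoly
    rw [AlgHom.map_det, ← det_pow, charmatrix, RingHom.mapMatrix_apply, charmatrix]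
    have : CharP (Matrix ι ι K[X]) p := Matrix.charP p
    rw [sub_pow_char_of_commute]
    · congr 1
      ext i j : 2
      simp [Matrix.sub_apply, Matrix.scalar_apply, Matrix.diagonal_apply, Matrix.diagonal_pow,  ← Matrix.map_pow]
      split_ifs <;> simp
    · exact (Matrix.scalar_commute _ (fun _ => Commute.all _ _) _)
  · simp [Matrix.charpoly, Matrix.det_isEmpty]

theorem LinearMap.trace_pow_char {K : Type*} [Field K] (p : ℕ) [Fact p.Prime] [CharP K p] {V : Type*}
   [AddCommGroup V] [Module K V] [FiniteDimensional K V] (f : Module.End K V) :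
   LinearMap.trace K V (f ^ p) = LinearMap.trace K V f ^ p := by
  set b := Module.finBasis K V
  rw [LinearMap.trace_eq_matrix_trace K b, LinearMap.trace_eq_matrix_trace K b]
  change (LinearMap.toMatrixAlgEquiv b (f ^ p)).trace = (LinearMap.toMatrixAlgEquiv b f).trace ^ p
  rw [map_pow]
  generalize LinearMap.toMatrixAlgEquiv b f = M
  have hp : p ≠ 0 := (Fact.out : p.Prime).ne_zero
  cases isEmpty_or_nonempty (Fin (Module.finrank K V))
  · simp [Matrix.trace, hp]
  rw [Matrix.trace_eq_neg_charpoly_coeff, Matrix.trace_eq_neg_charpoly_coeff, neg_pow]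
  have := congrArg (fun P => Polynomial.coeff P ((Fintype.card (Fin (Module.finrank K V)) - 1) * p))
    (Matrix.charpoly_pow_char_expand p M)
  simp only [Polynomial.coeff_expand_mul (Nat.pos_of_ne_zero hp)] at this
  rw [this, ← Polynomial.map_frobenius_expand p, Polynomial.coeff_map,
    Polynomial.coeff_expand_mul (Nat.pos_of_ne_zero hp), _root_.frobenius_def, show (-1 : K) ^ p = -1 by
      have := map_neg (_root_.frobenius K p) 1
      simpa [_root_.frobenius_def] using this]
  ring

section Norms

variable {k : Type*} [Field k] {E F : Type*} [AddCommGroup E] [Module k E]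
  [AddCommGroup F] [Module k F]

/-- `x` lies in the image of the norm `1 + T + ⋯ + T ^ (m - 1)`. -/
def IsNorm (T : Module.End k E) (m : ℕ) (x : E) : Prop :=
  ∃ h, x = ∑ j ∈ range m, (T ^ j) h

theorem IsNorm.map {T : Module.End k E} {T' : Module.End k F} {m : ℕ} {x : E}
    (hx : IsNorm T m x) (Φ : E →ₗ[k] F) (hΦ : ∀ h, Φ (T h) = T' (Φ h)) :
    IsNorm T' m (Φ x) := by
  obtain ⟨h, rfl⟩ := hx
  refine ⟨Φ h, ?_⟩
  have key : ∀ j : ℕ, Φ ((T ^ j) h) = (T' ^ j) (Φ h) := by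
    intro j
    induction j with
    | zero => simp
    | succ j ih => rw [pow_succ', pow_succ', Module.End.mul_apply, Module.End.mul_apply, hΦ, ih]
  simp [map_sum, key]

theorem IsNorm.add {T : Module.End k E} {m : ℕ} {x y : E} (hx : IsNorm T m x)
    (hy : IsNorm T m y) : IsNorm T m (x + y) := by
  obtain ⟨h, rfl⟩ := hx
  obtain ⟨h', rfl⟩ := hy
  exact ⟨h + h', by simp [sum_add_distrib]⟩

theorem IsNorm.neg {T : Module.End k E} {m : ℕ} {x : E} (hx : IsNorm T m x) :
    IsNorm T m (-x) := by
  obtain ⟨h, rfl⟩ := hx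
  exact ⟨-h, by simp⟩

theorem IsNorm.sub {T : Module.End k E} {m : ℕ} {x y : E} (hx : IsNorm T m x)
    (hy : IsNorm T m y) : IsNorm T m (x - y) := by
  simpa [sub_eq_add_neg] using hx.add hy.neg

theorem IsNorm.zero (T : Module.End k E) (m : ℕ) : IsNorm T m 0 := ⟨0, by simp⟩

theorem IsNorm.smul {T : Module.End k E} {m : ℕ} {x : E} (c : k) (hx : IsNorm T m x) :
    IsNorm T m (c • x) := by
  obtain ⟨h, rfl⟩ := hx
  exact ⟨c • h, by simp [smul_sum]⟩

theorem IsNorm.of_mul {T : Module.End k E} {m r : ℕ} {x : E} (hx : IsNorm T (m * r) x) :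
    IsNorm (T ^ r) m x := by
  obtain ⟨h, rfl⟩ := hx
  refine ⟨∑ b ∈ range r, (T ^ b) h, ?_⟩
  induction m with
  | zero => simp
  | succ m ih =>
    rw [Nat.succ_mul, sum_range_add, ih, sum_range_succ, map_sum, mul_comm m r]
    simp only [pow_add, pow_mul, Module.End.mul_apply]

theorem IsNorm.eq_zero {m : ℕ} {x : E} (hm : (m : k) = 0) (hx : IsNorm (1 : Module.End k E) m x) :
    x = 0 := by
  obtain ⟨h, rfl⟩ := hx
  simp [← Nat.cast_smul_eq_nsmul k, hm]

theorem conj_pow_iterate_apply (e : E ≃ₗ[k] E) (h : Module.End k E) (c : ℕ) (x : E) :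
    (((e.conj.toLinearMap : Module.End k (Module.End k E)) ^ c) h) ((⇑e)^[c] x)
      = (⇑e)^[c] (h x) := by
  induction c generalizing x with
  | zero => rfl
  | succ c ih =>
    rw [pow_succ', Module.End.mul_apply, Function.iterate_succ_apply',
      Function.iterate_succ_apply', LinearEquiv.coe_coe, LinearEquiv.conj_apply_apply,
      LinearEquiv.symm_apply_apply, ih]

theorem iterate_map_smul' (e : E ≃ₗ[k] E) (c : ℕ) (a : k) (x : E) :
    (⇑e)^[c] (a • x) = a • (⇑e)^[c] x := by
  induction c with
  | zero => rfl
  | succ c ih => rw [Function.iterate_succ_apply', Function.iterate_succ_apply', ih, map_smul]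

end Norms

theorem AlgEquiv.pow_apply_eq {R B : Type*} [CommSemiring R] [Semiring B] [Algebra R B]
    (e : B ≃ₐ[R] B) (a : ℕ) (f : B) : (e ^ a) f = ((e : B →ₐ[R] B) ^ a) f := by
  induction a generalizing f with
  | zero => rfl
  | succ a ih => rw [pow_succ, pow_succ, AlgEquiv.mul_apply, ih]; rfl

section Fock

open MvPolynomial

variable (k : Type*) [Field k] (i : ℕ)

/-- The variables of `k[X₀, …, Xᵢ₋₁]`, extended by zero. -/
noncomputable def varExt (l : ℕ) : MvPolynomial (Fin i) k :=
  if h : l < i then X ⟨l, h⟩ else 0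

/-- The partial derivatives of `k[X₀, …, Xᵢ₋₁]`, extended by zero. -/
noncomputable def pderivExt (l : ℕ) : Module.End k (MvPolynomial (Fin i) k) :=
  if h : l < i then (pderiv (R := k) (⟨l, h⟩ : Fin i)).toLinearMap else 0

variable {k i}

theorem varExt_of_lt {l : ℕ} (h : l < i) : varExt k i l = X ⟨l, h⟩ := dif_pos h

theorem varExt_of_le {l : ℕ} (h : i ≤ l) : varExt k i l = 0 := dif_neg (not_lt.2 h)

theorem shift_pow_varExt {g₀ : MvPolynomial (Fin i) k →ₐ[k] MvPolynomial (Fin i) k}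
    (hg : ∀ l, g₀ (varExt k i l) = varExt k i l + varExt k i (l + 1)) :
    ∀ a l, (g₀ ^ a) (varExt k i l)
        = ∑ j ∈ range (a + 1), a.choose j • varExt k i (l + j) := by
  intro a
  induction a with
  | zero => intro l; simp
  | succ a ih =>
    intro l
    rw [pow_succ, AlgHom.mul_apply, hg, map_add, ih, ih, sum_range_succ' _ (a + 1),
      sum_range_succ' _ a]
    have : ∑ j ∈ range (a + 1), (a + 1).choose (j + 1) • varExt k i (l + (j + 1))
        = ∑ j ∈ range (a + 1), a.choose j • varExt k i (l + 1 + j)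
          + ∑ j ∈ range (a + 1), a.choose (j + 1) • varExt k i (l + (j + 1)) := by
      rw [← sum_add_distrib]
      refine sum_congr rfl fun j _ => ?_
      rw [Nat.choose_succ_succ, add_smul, add_assoc l 1 j, add_comm 1 j]
    rw [this, sum_range_succ (fun j => a.choose (j + 1) • varExt k i (l + (j + 1))) a]
    simp
    ring

variable (k i) in
theorem exists_shift (p : ℕ) [Fact p.Prime] [CharP k p] (hi : i ≤ p) :
    ∃ g : MvPolynomial (Fin i) k ≃ₐ[k] MvPolynomial (Fin i) k,
      (∀ l, g (varExt k i l) = varExt k i l + varExt k i (l + 1)) ∧ g ^ p = 1 := by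
  set g₀ : MvPolynomial (Fin i) k →ₐ[k] MvPolynomial (Fin i) k :=
    aeval (fun l : Fin i => varExt k i l + varExt k i (l + 1)) with hg₀
  have hg : ∀ l, g₀ (varExt k i l) = varExt k i l + varExt k i (l + 1) := by
    intro l
    rcases lt_or_ge l i with h | h
    · rw [varExt_of_lt h, hg₀, aeval_X, varExt_of_lt h]
    · rw [varExt_of_le h, varExt_of_le (by omega), map_zero, add_zero]
  have hpow := fun a l => shift_pow_varExt hg a l
  have hgp : g₀ ^ p = 1 := by
    refine MvPolynomial.algHom_ext fun l => ?_
    have h := hpow p l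
    rw [varExt_of_lt l.2] at h
    rw [show (X l : MvPolynomial (Fin i) k) = X ⟨l, l.2⟩ from rfl, h, sum_range_succ,
      sum_eq_single 0]
    · simp [varExt_of_le (show i ≤ l + p by omega), varExt_of_lt l.2]
    · intro j hj hj0
      have : (p.choose j : k) = 0 := (CharP.cast_eq_zero_iff k p _).2
        ((Fact.out : p.Prime).dvd_choose_self hj0 (by simpa using hj))
      rw [← Nat.cast_smul_eq_nsmul k, this, zero_smul]
    · intro h
      exact absurd (mem_range.2 (Fact.out : p.Prime).pos) h
  have h1 : g₀ * g₀ ^ (p - 1) = 1 := by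
    rw [← pow_succ', Nat.sub_add_cancel (Fact.out : p.Prime).one_le, hgp]
  have h2 : g₀ ^ (p - 1) * g₀ = 1 := by
    rw [← pow_succ, Nat.sub_add_cancel (Fact.out : p.Prime).one_le, hgp]
  refine ⟨AlgEquiv.ofAlgHom g₀ (g₀ ^ (p - 1)) h1 h2, hg, ?_⟩
  ext1 f
  rw [AlgEquiv.pow_apply_eq, show ((AlgEquiv.ofAlgHom g₀ (g₀ ^ (p - 1)) h1 h2 :
    MvPolynomial (Fin i) k ≃ₐ[k] MvPolynomial (Fin i) k) :
    MvPolynomial (Fin i) k →ₐ[k] MvPolynomial (Fin i) k) = g₀ from rfl, hgp]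
  rfl

theorem pderivExt_C (l : ℕ) (a : k) : pderivExt k i l (C a) = 0 := by
  unfold pderivExt
  split_ifs <;> simp

theorem pderivExt_mul (l : ℕ) (f f' : MvPolynomial (Fin i) k) :
    pderivExt k i l (f * f') = pderivExt k i l f * f' + f * pderivExt k i l f' := by
  unfold pderivExt
  split_ifs
  · simp [Derivation.leibniz]
    ring
  · simp

theorem pderivExt_varExt {l j : ℕ} (hl : l < i) :
    pderivExt k i l (varExt k i j) = if l = j then 1 else 0 := by
  unfold pderivExt varExt
  rw [dif_pos hl]
  by_cases hj : j < i
  · simp [hj, pderiv_X, Pi.single_apply, eq_comm]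
  · rw [dif_neg hj, if_neg (by omega), map_zero]

theorem pderivExt_zero_shift (hi : 0 < i)
    {g : MvPolynomial (Fin i) k ≃ₐ[k] MvPolynomial (Fin i) k}
    (hg : ∀ l, g (varExt k i l) = varExt k i l + varExt k i (l + 1)) (f) :
    pderivExt k i 0 (g f) = g (pderivExt k i 0 f) := by
  induction f using MvPolynomial.induction_on with
  | C a =>
    rw [pderivExt_C, ← MvPolynomial.algebraMap_eq, AlgEquiv.commutes, MvPolynomial.algebraMap_eq,
      pderivExt_C, map_zero]
  | add f f' h h' => simp only [map_add, h, h']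
  | mul_X f j h =>
    have hX : (X j : MvPolynomial (Fin i) k) = varExt k i j := by rw [varExt_of_lt j.2]
    rw [map_mul, pderivExt_mul, pderivExt_mul, h, hX, hg, map_add, map_add, map_mul, map_mul, hg,
      pderivExt_varExt hi, pderivExt_varExt hi]
    simp [apply_ite g]

theorem pderivExt_succ_shift {l : ℕ} (hl : l + 1 < i)
    {g : MvPolynomial (Fin i) k ≃ₐ[k] MvPolynomial (Fin i) k}
    (hg : ∀ l, g (varExt k i l) = varExt k i l + varExt k i (l + 1)) (f) :
    pderivExt k i (l + 1) (g f) = g (pderivExt k i (l + 1) f) + g (pderivExt k i l f) := by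
  induction f using MvPolynomial.induction_on with
  | C a =>
    rw [pderivExt_C, pderivExt_C, ← MvPolynomial.algebraMap_eq, AlgEquiv.commutes,
      MvPolynomial.algebraMap_eq, pderivExt_C, map_zero, add_zero]
  | add f f' h h' =>
    simp only [map_add, h, h']
    ring
  | mul_X f j h =>
    have hX : (X j : MvPolynomial (Fin i) k) = varExt k i j := by rw [varExt_of_lt j.2]
    rw [map_mul, pderivExt_mul, pderivExt_mul, pderivExt_mul, h, hX, hg, map_add, map_add, map_add,
      map_mul, map_mul, map_mul, map_mul, hg,
      pderivExt_varExt hl, pderivExt_varExt hl, pderivExt_varExt (by omega : l < i)]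
    simp only [add_left_inj]
    split_ifs <;> simp only [map_one, map_zero] <;> ring

end Fock

section Fock

open MvPolynomial

variable {k : Type*} [Field k] {i : ℕ}

theorem finrank_homogeneousSubmodule_le (m : ℕ) :
    Module.finrank k (homogeneousSubmodule (Fin i) k m) ≤ (m + i - 1).choose m := by
  classical
  have : homogeneousSubmodule (Fin i) k m = Submodule.span k
      (((Finset.univ : Finset (Fin i)).finsuppAntidiag m).image
        (fun d => monomial d (1 : k)) : Finset (MvPolynomial (Fin i) k)) := by
    refine le_antisymm ?_ ?_
    · intro f hf
      rw [f.as_sum]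
      refine Submodule.sum_mem _ fun d hd => ?_
      rw [← mul_one (coeff d f), ← smul_eq_mul, ← smul_monomial]
      refine Submodule.smul_mem _ _ (Submodule.subset_span ?_)
      rw [Finset.coe_image]
      refine ⟨d, ?_, rfl⟩
      rw [mem_homogeneousSubmodule] at hf
      have := hf (mem_support_iff.1 hd)
      simp only [mem_coe, mem_finsuppAntidiag, subset_univ, and_true]
      rw [← this, Pi.one_def, ← Finsupp.degree_eq_weight_one, Finsupp.degree_eq_sum]
    · rw [Submodule.span_le]
      rintro _ h
      rw [Finset.coe_image] at h
      obtain ⟨d, hd, rfl⟩ := h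
      simp only [mem_coe, mem_finsuppAntidiag, subset_univ, and_true] at hd
      refine isHomogeneous_monomial _ ?_
      rw [Finsupp.degree_eq_sum, hd]
  rw [this]
  refine (finrank_span_finset_le_card _).trans (card_image_le.trans ?_)
  rw [card_finsuppAntidiag_nat_eq_choose]
  simp [add_comm]

theorem exists_eval_varExt (ω : Polynomial k) (hω : ω.natDegree < i) :
    ∃ d : Fin i → k, ∀ a : ℕ,
      aeval d (∑ j ∈ range (a + 1), a.choose j • varExt k i j) = ω.eval (a : k) := by
  refine ⟨fun l => (fwdDiff (1 : k))^[l] ω.eval 0, fun a => ?_⟩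
  have := shift_eq_sum_fwdDiff_iter (1 : k) ω.eval a 0
  rw [zero_add, nsmul_one] at this
  rw [this, map_sum]
  refine sum_congr rfl fun j _ => ?_
  rw [map_nsmul]
  congr 1
  rcases lt_or_ge j i with h | h
  · rw [varExt_of_lt h, aeval_X]
  · rw [varExt_of_le h, map_zero, Polynomial.fwdDiff_iter_eq_zero_of_degree_lt (by omega)]
    rfl

variable {p : ℕ}

/-- The `p` translates of the first variable under a shift of order `p`. -/
noncomputable def shiftVar (g : MvPolynomial (Fin i) k ≃ₐ[k] MvPolynomial (Fin i) k)
    (a : ZMod p) : MvPolynomial (Fin i) k :=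
  (g ^ a.val) (varExt k i 0)

variable {g : MvPolynomial (Fin i) k ≃ₐ[k] MvPolynomial (Fin i) k}

theorem shift_shiftVar [Fact p.Prime] (hgp : g ^ p = 1) (a : ZMod p) :
    g (shiftVar g a) = shiftVar g (a + 1) := by
  have : g ^ (a + 1).val = g ^ (a.val + 1) := by
    rw [ZMod.val_add, ← pow_eq_pow_mod _ hgp, ZMod.val_one_eq_one_mod]
    rcases eq_or_ne p 1 with h | h
    · exact absurd h (Fact.out : p.Prime).ne_one
    · rw [Nat.mod_eq_of_lt (Fact.out : p.Prime).one_lt]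
  rw [shiftVar, shiftVar, this, pow_succ', AlgEquiv.mul_apply]

theorem exists_eval_shiftVar [Fact p.Prime]
    (hg : ∀ l, g (varExt k i l) = varExt k i l + varExt k i (l + 1))
    (ω : Polynomial k) (hω : ω.natDegree < i) :
    ∃ d : Fin i → k, ∀ a : ZMod p, aeval d (shiftVar g a) = ω.eval (a.cast : k) := by
  obtain ⟨d, hd⟩ := exists_eval_varExt ω hω
  refine ⟨d, fun a => ?_⟩
  rw [shiftVar, AlgEquiv.pow_apply_eq, shift_pow_varExt (by simpa using hg)]
  simp only [zero_add]
  rw [hd, ZMod.natCast_val]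

/-- Products of distinct translates of the first variable. -/
noncomputable def shiftProd (g : MvPolynomial (Fin i) k ≃ₐ[k] MvPolynomial (Fin i) k)
    (T : Finset (ZMod p)) : MvPolynomial (Fin i) k :=
  ∏ a ∈ T, shiftVar g a

theorem exists_eval_shiftProd [Fact p.Prime] [CharP k p]
    (hg : ∀ l, g (varExt k i l) = varExt k i l + varExt k i (l + 1))
    {m : ℕ} (hm : m + i = p + 1) (T : Finset (ZMod p)) (hT : T.card = m) :
    ∃ d : Fin i → k, ∀ T' : Finset (ZMod p), T'.card = m →
      (aeval d (shiftProd g T') ≠ 0 ↔ T' = T) := by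
  obtain ⟨d, hd⟩ := exists_eval_shiftVar (p := p) hg
    (∏ c ∈ Tᶜ, (Polynomial.X - Polynomial.C (c.cast : k))) (by
      rw [Polynomial.natDegree_prod _ _ fun c _ => Polynomial.X_sub_C_ne_zero _]
      have := card_add_card_compl T
      rw [ZMod.card] at this
      simp
      omega)
  refine ⟨d, fun T' hT' => ?_⟩
  have hcast : Function.Injective (fun a : ZMod p => (a.cast : k)) :=
    (ZMod.castHom dvd_rfl k).injective
  rw [shiftProd, map_prod, prod_ne_zero_iff]
  simp only [hd, Polynomial.eval_prod, prod_ne_zero_iff, Polynomial.eval_sub, Polynomial.eval_X,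
    Polynomial.eval_C, sub_ne_zero, hcast.ne_iff, mem_compl]
  constructor
  · intro h
    refine eq_of_subset_of_card_le (fun a ha => ?_) (by rw [hT, hT'])
    by_contra haT
    exact h a ha a haT rfl
  · rintro rfl a ha c hc rfl
    exact hc ha

theorem shiftProd_isHomogeneous
    (hg : ∀ l, g (varExt k i l) = varExt k i l + varExt k i (l + 1)) (T : Finset (ZMod p)) :
    (shiftProd g T).IsHomogeneous T.card := by
  rw [card_eq_sum_ones]
  refine IsHomogeneous.prod _ _ _ fun a _ => ?_
  rw [shiftVar, AlgEquiv.pow_apply_eq, shift_pow_varExt (by simpa using hg)]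
  refine IsHomogeneous.sum _ _ _ fun j _ => ?_
  rw [← mem_homogeneousSubmodule]
  refine Submodule.smul_of_tower_mem _ _ ?_
  rw [mem_homogeneousSubmodule]
  rcases lt_or_ge (0 + j) i with h | h
  · rw [varExt_of_lt h]
    exact isHomogeneous_X _ _
  · rw [varExt_of_le h]
    exact isHomogeneous_zero _ _ _

theorem homogeneousSubmodule_le_span_shiftProd [Fact p.Prime] [CharP k p]
    (hg : ∀ l, g (varExt k i l) = varExt k i l + varExt k i (l + 1))
    {m : ℕ} (hm : m + i = p + 1) :
    homogeneousSubmodule (Fin i) k m ≤ Submodule.span k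
      (Set.range fun T : {T : Finset (ZMod p) // T.card = m} => shiftProd g T.1) := by
  classical
  set f : {T : Finset (ZMod p) // T.card = m} → homogeneousSubmodule (Fin i) k m :=
    fun T => ⟨shiftProd g T.1, by
      simpa [T.2] using shiftProd_isHomogeneous hg T.1⟩ with hf
  choose d hd using fun T : {T : Finset (ZMod p) // T.card = m} =>
    exists_eval_shiftProd hg hm T.1 T.2
  have hli : LinearIndependent k f := by
    rw [Fintype.linearIndependent_iff]
    intro c hc T
    have h := congrArg (fun P : homogeneousSubmodule (Fin i) k m =>
      aeval (d T) (P : MvPolynomial (Fin i) k)) hc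
    simp only [hf, Submodule.coe_sum, Submodule.coe_smul, map_sum, map_smul,
      ZeroMemClass.coe_zero, map_zero] at h
    rw [sum_eq_single T] at h
    · exact (smul_eq_zero.1 h).resolve_right ((hd T T.1 T.2).2 rfl)
    · intro T' _ hT'
      have := mt (hd T T'.1 T'.2).1 (fun h => hT' (Subtype.ext h))
      rw [not_not.1 this, smul_zero]
    · simp
  have hcard : Fintype.card {T : Finset (ZMod p) // T.card = m} = p.choose m := by
    rw [Fintype.card_finset_len, ZMod.card]
  have : Module.Finite k (homogeneousSubmodule (Fin i) k m) :=
    Module.Finite.iff_fg.2 (homogeneousSubmodule_fg _ _ m)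
  have hspan := hli.span_eq_top_of_card_eq_finrank' (le_antisymm hli.fintype_card_le_finrank (by
    rw [hcard]
    refine (finrank_homogeneousSubmodule_le m).trans ?_
    rw [show m + i - 1 = p by omega]))
  intro P hP
  have : (⟨P, hP⟩ : homogeneousSubmodule (Fin i) k m) ∈ Submodule.span k (Set.range f) := by
    rw [hspan]; trivial
  have := Submodule.mem_map_of_mem (f := (homogeneousSubmodule (Fin i) k m).subtype) this
  rw [Submodule.map_span, ← Set.range_comp] at this
  exact this

theorem iterate_shift_shiftProd [Fact p.Prime] (hgp : g ^ p = 1) (c : ℕ) (T : Finset (ZMod p)) :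
    (⇑g.toLinearEquiv)^[c] (shiftProd g T) =
      shiftProd g (T.map (addRightEmbedding (c : ZMod p))) := by
  induction c with
  | zero =>
    refine congrArg (shiftProd g) (Finset.ext fun a => ?_)
    simp [addRightEmbedding]
  | succ c ih =>
    rw [Function.iterate_succ_apply', ih, shiftProd, shiftProd, AlgEquiv.toLinearEquiv_apply,
      map_prod, prod_map, prod_map]
    refine prod_congr rfl fun a _ => ?_
    rw [shift_shiftVar hgp]
    simp [add_assoc]

theorem exists_norm_eq_id_on_homogeneousSubmodule [Fact p.Prime] [CharP k p]
    (hg : ∀ l, g (varExt k i l) = varExt k i l + varExt k i (l + 1)) (hgp : g ^ p = 1)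
    {m : ℕ} (hm : m + i = p + 1) (hm0 : 0 < m) (hmp : m < p) :
    ∃ h : Module.End k (MvPolynomial (Fin i) k), ∀ P ∈ homogeneousSubmodule (Fin i) k m,
      (∑ c ∈ range p, ((g.toLinearEquiv.conj.toLinearMap : Module.End k _) ^ c) h) P = P := by
  classical
  choose d hd using fun T : {T : Finset (ZMod p) // T.card = m} =>
    exists_eval_shiftProd hg hm T.1 T.2
  have hmk : (m : k) ≠ 0 := by
    rw [Ne, CharP.cast_eq_zero_iff k p]
    exact Nat.not_dvd_of_pos_of_lt hm0 hmp
  set h : Module.End k (MvPolynomial (Fin i) k) :=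
    ∑ T : {T : Finset (ZMod p) // T.card = m},
      (if 0 ∈ T.1 then (m : k)⁻¹ * (aeval (d T) (shiftProd g T.1))⁻¹ else 0) •
        (aeval (d T)).toLinearMap.smulRight (shiftProd g T.1) with hh
  have hT : ∀ T : Finset (ZMod p), T.card = m →
      h (shiftProd g T) = (if 0 ∈ T then (m : k)⁻¹ else 0) • shiftProd g T := by
    intro T hTm
    rw [hh, LinearMap.sum_apply, sum_eq_single ⟨T, hTm⟩]
    · have := (hd ⟨T, hTm⟩ T hTm).2 rfl
      rw [LinearMap.smul_apply, LinearMap.smulRight_apply, smul_smul]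
      congr 1
      split_ifs
      · simp only [AlgHom.toLinearMap_apply]
        field_simp
      · simp
    · intro T' _ hT'
      have := mt (hd T' T hTm).1 (fun h => hT' (Subtype.ext h.symm))
      rw [LinearMap.smul_apply, LinearMap.smulRight_apply, AlgHom.toLinearMap_apply,
        not_not.1 this, zero_smul, smul_zero]
    · simp
  refine ⟨h, fun P hP => ?_⟩
  have hspan := homogeneousSubmodule_le_span_shiftProd (g := g) hg hm hP
  clear hP
  induction hspan using Submodule.span_induction with
  | zero => simp
  | add x y _ _ hx hy => rw [map_add, hx, hy]
  | smul c x _ hx => rw [map_smul, hx]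
  | mem x hx =>
  obtain ⟨⟨T, hTm⟩, rfl⟩ := hx
  rw [LinearMap.sum_apply]
  have key : ∀ c ∈ range p, ((((g.toLinearEquiv.conj.toLinearMap : Module.End k _) ^ c) h)
      (shiftProd g T)) = (if (c : ZMod p) ∈ T then (m : k)⁻¹ else 0) • shiftProd g T := by
    intro c _
    have hTc : T = (T.map (addRightEmbedding (-(c : ZMod p)))).map
        (addRightEmbedding (c : ZMod p)) := by
      ext x
      simp
    have h1 : shiftProd g T = (⇑g.toLinearEquiv)^[c]
        (shiftProd g (T.map (addRightEmbedding (-(c : ZMod p))))) := by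
      rw [iterate_shift_shiftProd hgp, ← hTc]
    conv_lhs => rw [h1]
    rw [conj_pow_iterate_apply, hT _ (by simpa using hTm), iterate_map_smul', ← h1]
    simp [add_neg_eq_zero]
  rw [sum_congr rfl key, ← sum_smul, ← sum_filter, sum_const]
  have : #((range p).filter fun c : ℕ => (c : ZMod p) ∈ T) = T.card := by
    refine card_nbij' (fun c : ℕ => (c : ZMod p)) ZMod.val ?_ ?_ ?_ ?_
    · intro c; simp
    · intro a ha
      simpa [ZMod.val_lt] using ha
    · intro c hc
      simp only [coe_filter, mem_range, Set.mem_ofPred_eq] at hc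
      exact ZMod.val_cast_of_lt hc.1
    · intro a _
      simp
  rw [this, hTm, nsmul_eq_mul, mul_inv_cancel₀ hmk, one_smul]

end Fock

section Weyl

variable {R : Type*} [Ring R] {S : Submonoid R} {I : AddSubgroup R}

theorem mul_pow_sub_pow_mul_mem (hl : ∀ a ∈ S, ∀ b ∈ I, a * b ∈ I)
    (hr : ∀ a ∈ S, ∀ b ∈ I, b * a ∈ I) {x D : R} (hx : x ∈ S)
    (h : x * D - D * x ∈ I) (j : ℕ) : D * x ^ j - x ^ j * D ∈ I := by
  induction j with
  | zero => simp
  | succ j ih =>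
    have : D * x ^ (j + 1) - x ^ (j + 1) * D
        = (D * x ^ j - x ^ j * D) * x - x ^ j * (x * D - D * x) := by
      rw [pow_succ]; noncomm_ring
    rw [this]
    exact I.sub_mem (hr _ hx _ ih) (hl _ (S.pow_mem hx j) _ h)

theorem factorial_smul_mem_of_weyl (hl : ∀ a ∈ S, ∀ b ∈ I, a * b ∈ I)
    (hr : ∀ a ∈ S, ∀ b ∈ I, b * a ∈ I) {x y D e : R} (hx : x ∈ S) (hy : y ∈ S) (hD : D ∈ S)
    (he : e ∈ S) (hyx : y * x - x * y - D ∈ I) (hxD : x * D - D * x ∈ I) (hye : y * e = 0)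
    (hDe : D * e = e * D) {m : ℕ} (hm : x ^ m * e ∈ I) : m.factorial • (e * D ^ m) ∈ I := by
  have h1 : ∀ j : ℕ, y * x ^ (j + 1) * e - (j + 1) • (x ^ j * e * D) ∈ I := by
    intro j
    induction j with
    | zero =>
      have : y * x ^ (0 + 1) * e - (0 + 1) • (x ^ 0 * e * D) = (y * x - x * y - D) * e := by
        rw [sub_mul, sub_mul, mul_assoc x y e, hye, hDe]; simp
      rw [this]
      exact hr _ he _ hyx
    | succ j ih =>
      have : y * x ^ (j + 1 + 1) * e - (j + 1 + 1) • (x ^ (j + 1) * e * D)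
          = (y * x - x * y - D) * (x ^ (j + 1) * e)
            + x * (y * x ^ (j + 1) * e - (j + 1) • (x ^ j * e * D))
            + (D * x ^ (j + 1) - x ^ (j + 1) * D) * e
            + (x ^ (j + 1) * (D * e) - x ^ (j + 1) * (e * D)) := by
        rw [pow_succ' x (j + 1), add_smul (j + 1) 1, mul_sub, mul_smul_comm, pow_succ' x j]
        noncomm_ring
      rw [this, hDe, sub_self, add_zero]
      exact I.add_mem (I.add_mem (hr _ (S.mul_mem (S.pow_mem hx _) he) _ hyx) (hl _ hx _ ih))
        (hr _ he _ (mul_pow_sub_pow_mul_mem hl hr hx hxD _))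
  have h2 : ∀ j : ℕ, y ^ j * (x ^ j * e) - j.factorial • (e * D ^ j) ∈ I := by
    intro j
    induction j with
    | zero => simp
    | succ j ih =>
      have : y ^ (j + 1) * (x ^ (j + 1) * e) - (j + 1).factorial • (e * D ^ (j + 1))
          = y ^ j * (y * x ^ (j + 1) * e - (j + 1) • (x ^ j * e * D))
            + (j + 1) • ((y ^ j * (x ^ j * e) - j.factorial • (e * D ^ j)) * D) := by
        rw [sub_mul, mul_sub, smul_sub, Nat.factorial_succ, mul_smul, smul_mul_assoc, pow_succ y,
          pow_succ D, mul_smul_comm]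
        simp only [mul_assoc]
        abel
      rw [this]
      exact I.add_mem (hl _ (S.pow_mem hy _) _ (h1 j)) (I.nsmul_mem (hr _ hD _ ih) _)
  have := I.sub_mem (hl _ (S.pow_mem hy m) _ hm) (h2 m)
  simpa using this

end Weyl

section Abel

variable {M N Q : Type*} [AddCommGroup M] [AddCommGroup N] [AddCommGroup Q]

theorem sum_range_shift_pairing {f : M → N → Q} (h1 : ∀ a a' b, f (a + a') b = f a b + f a' b)
    (h2 : ∀ a b b', f a (b + b') = f a b + f a b') {i : ℕ} {a a' : ℕ → M} {b b' : ℕ → N}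
    (ha0 : 0 < i → a' 0 = a 0) (ha : ∀ l, l + 1 < i → a' (l + 1) = a (l + 1) + a l)
    (hb : ∀ l, b' l = b l + b (l + 1)) (hbi : b i = 0) :
    ∑ l ∈ range i, f (a l) (b' l) = ∑ l ∈ range i, f (a' l) (b l) := by
  have key : ∀ j, j ≤ i → ∑ l ∈ range j, f (a l) (b' l)
      = ∑ l ∈ range j, f (a' l) (b l) + if j = 0 then 0 else f (a (j - 1)) (b j) := by
    intro j
    induction j with
    | zero => simp
    | succ j ih =>
      intro hj
      rw [sum_range_succ, sum_range_succ, ih (by omega), hb, h2]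
      rcases j with _ | j
      · simp [ha0 (by omega)]
      · simp [ha j (by omega), h1]
        abel
  have hz : ∀ a, f a 0 = 0 := fun a => by simpa using h2 a 0 0
  rw [key i le_rfl, hbi, hz]
  simp

end Abel

section AbstractWeyl

variable {k : Type*} [Field k] {A : Type*} [AddCommGroup A] [Module k A]
  {O E R : Type*} [Ring O] [Algebra k O] [Ring E] [Algebra k E] [Ring R] [Algebra k R]

/-- The commutators of the values of a linear map. -/
noncomputable def commutatorMap (L : A →ₗ[k] E) : A →ₗ[k] A →ₗ[k] E :=
  (LinearMap.mul k E).compl₁₂ L L - ((LinearMap.mul k E).compl₁₂ L L).flip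

theorem commutatorMap_apply (L : A →ₗ[k] E) (a b : A) :
    commutatorMap L a b = L a * L b - L b * L a := by
  simp [commutatorMap]

variable {B : O →ₗ[k] E →ₗ[k] R} {gO : O →ₗ[k] O} {uE : E ≃ₗ[k] E} {gR : R →ₗ[k] R}
  {u : A ≃ₗ[k] A} {L : A →ₗ[k] E} {i p : ℕ} {y v : ℕ → A} {X δ : ℕ → O}

theorem arrowCongr_apply_apply_apply (h : A →ₗ[k] A →ₗ[k] E) (a b : A) :
    (u.arrowCongr (u.arrowCongr uE)).toLinearMap h (u a) (u b) = uE (h a b) := by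
  simp [LinearEquiv.arrowCongr_apply]

theorem isNorm_weyl (hB : ∀ o o' f f', B (o * o') (f * f') = B o f * B o' f')
    (hgO : ∀ o o', gO (o * o') = gO o * gO o')
    (hgR : ∀ o f, gR (B o f) = B (gO o) (uE f))
    (hc : IsNorm (u.arrowCongr (u.arrowCongr uE)).toLinearMap p (commutatorMap L))
    (hX : ∀ l, gO (X l) = X l + X (l + 1)) (hXi : X i = 0)
    (h0 : 0 < i → δ 0 = gO (δ 0)) (hs : ∀ l, l + 1 < i → δ (l + 1) = gO (δ (l + 1)) + gO (δ l))
    (hcom : ∀ j < i, ∀ l, δ j * X l = X l * δ j + if j = l then 1 else 0)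
    (hy : ∀ l, u (y l) = y l + y (l + 1)) (hyi : y i = 0) (hv0 : u (v 0) = v 0)
    (hv : ∀ l, l + 1 < i → v (l + 1) = u (v (l + 1)) + u (v l)) :
    IsNorm gR p ((∑ l ∈ range i, B (δ l) (L (y l))) * (∑ l ∈ range i, B (X l) (L (v l)))
      - (∑ l ∈ range i, B (X l) (L (v l))) * (∑ l ∈ range i, B (δ l) (L (y l)))
      - B 1 (∑ l ∈ range i, L (v l) * L (y l))) := by
  set W : (A →ₗ[k] A →ₗ[k] E) →ₗ[k] R := ∑ j ∈ range i, ∑ l ∈ range i,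
    B (δ j * X l) ∘ₗ (LinearMap.applyₗ (v l)) ∘ₗ (LinearMap.applyₗ (y j)) with hW
  have hWa : ∀ h, W h = ∑ j ∈ range i, ∑ l ∈ range i, B (δ j * X l) (h (y j) (v l)) := by
    intro h
    simp [hW]
  convert hc.map (T' := gR) W fun h => ?_ using 1
  · rw [hWa]
    have ht : ∀ j ∈ range i, ∀ l ∈ range i, B (δ j * X l) (commutatorMap L (y j) (v l))
        = B (δ j) (L (y j)) * B (X l) (L (v l)) - B (X l) (L (v l)) * B (δ j) (L (y j))
          - B (if j = l then 1 else 0) (L (v l) * L (y j)) := by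
      intro j hj l _
      rw [← hB, ← hB, commutatorMap_apply, map_sub, sub_sub, hcom j (mem_range.1 hj)]
      simp only [map_add, LinearMap.add_apply]
    rw [sum_congr rfl fun j hj => sum_congr rfl (ht j hj)]
    simp only [sum_sub_distrib]
    rw [sum_mul_sum, sum_mul_sum]
    congr 1
    · congr 1
      exact sum_comm
    · rw [map_sum]
      refine sum_congr rfl fun j hj => ?_
      rw [sum_eq_single_of_mem j hj]
      · simp
      · intro l _ hl
        simp [hl.symm]
  · rw [hWa, hWa]
    have key := arrowCongr_apply_apply_apply (u := u) (uE := uE) h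
    set h' := (u.arrowCongr (u.arrowCongr uE)).toLinearMap h
    simp only [map_sum, hgR, hgO, hX, ← key]
    calc _ = ∑ l ∈ range i, ∑ j ∈ range i, B (δ j * X l) (h' (y j) (v l)) := sum_comm
      _ = ∑ l ∈ range i, ∑ j ∈ range i, B (gO (δ j) * X l) (h' (u (y j)) (v l)) := by
          refine sum_congr rfl fun l _ => ?_
          exact (sum_range_shift_pairing (f := fun a b => B (a * X l) (h' b (v l)))
            (a := fun l => gO (δ l)) (by simp [add_mul]) (by simp) h0 hs hy hyi).symm
      _ = ∑ j ∈ range i, ∑ l ∈ range i, B (gO (δ j) * X l) (h' (u (y j)) (v l)) := sum_comm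
      _ = _ := by
          refine sum_congr rfl fun j _ => ?_
          exact (sum_range_shift_pairing (f := fun a b => B (gO (δ j) * b) (h' (u (y j)) a))
            (a := fun l => u (v l)) (by simp) (by simp [mul_add])
            (fun _ => hv0.symm) hv (fun _ => rfl) hXi).symm

theorem isNorm_sum_commutator (hB : ∀ o o' f f', B (o * o') (f * f') = B o f * B o' f')
    (huE : ∀ f f', uE (f * f') = uE f * uE f') (hL : ∀ a, L (u a) = uE (L a))
    (hgR : ∀ o f, gR (B o f) = B (gO o) (uE f))
    (hc : IsNorm (u.arrowCongr (u.arrowCongr uE)).toLinearMap p (commutatorMap L))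
    (hX : ∀ l, gO (X l) = X l + X (l + 1)) (hXi : X i = 0)
    (hy : ∀ l, u (y l) = y l + y (l + 1)) (hyi : y i = 0) (hv0 : u (v 0) = v 0)
    (hv : ∀ l, l + 1 < i → v (l + 1) = u (v (l + 1)) + u (v l)) :
    IsNorm gR p ((∑ l ∈ range i, B (X l) (L (v l))) * B 1 (∑ l ∈ range i, L (v l) * L (y l))
      - B 1 (∑ l ∈ range i, L (v l) * L (y l)) * (∑ l ∈ range i, B (X l) (L (v l)))) := by
  set W : (A →ₗ[k] A →ₗ[k] E) →ₗ[k] R := ∑ l ∈ range i, ∑ j ∈ range i, B (X l) ∘ₗ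
    (LinearMap.mulRight k (L (y j)) ∘ₗ LinearMap.applyₗ (v j) ∘ₗ LinearMap.applyₗ (v l)
      + LinearMap.mulLeft k (L (v j)) ∘ₗ LinearMap.applyₗ (y j) ∘ₗ LinearMap.applyₗ (v l))
    with hW
  have hWa : ∀ h, W h = ∑ l ∈ range i, ∑ j ∈ range i,
      B (X l) (h (v l) (v j) * L (y j) + L (v j) * h (v l) (y j)) := by
    intro h
    simp [hW]
  convert hc.map (T' := gR) W fun h => ?_ using 1
  · rw [hWa, sum_mul, mul_sum, ← sum_sub_distrib]
    refine sum_congr rfl fun l _ => ?_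
    rw [← hB, ← hB, mul_one, one_mul, ← map_sub, mul_sum, sum_mul, ← sum_sub_distrib, map_sum]
    refine sum_congr rfl fun j _ => ?_
    rw [commutatorMap_apply, commutatorMap_apply]
    congr 1
    noncomm_ring
  · rw [hWa, hWa]
    have key := arrowCongr_apply_apply_apply (u := u) (uE := uE) h
    set h' := (u.arrowCongr (u.arrowCongr uE)).toLinearMap h
    have key2 : ∀ l j, gR (B (X l) (h (v l) (v j) * L (y j) + L (v j) * h (v l) (y j)))
        = B (X l + X (l + 1))
          (h' (u (v l)) (u (v j)) * L (u (y j)) + L (u (v j)) * h' (u (v l)) (u (y j))) := by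
      intro l j
      rw [hgR, map_add uE, huE, huE, hX, key, key, hL, hL]
    rw [map_sum]
    simp only [map_sum gR, key2]
    calc _ = ∑ l ∈ range i, ∑ j ∈ range i,
            B (X l) (h' (v l) (u (v j)) * L (u (y j)) + L (u (v j)) * h' (v l) (u (y j))) := by
          refine sum_congr rfl fun l _ => ?_
          exact (sum_range_shift_pairing
            (f := fun a b => B (X l) (h' (v l) a * L b + L a * h' (v l) b))
            (a := fun l => u (v l))
            (fun a a' b => by
              rw [← map_add, map_add (h' (v l)), map_add L, add_mul, add_mul]
              congr 1; abel)
            (fun a b b' => by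
              rw [← map_add, map_add (h' (v l)), map_add L, mul_add, mul_add]
              congr 1; abel)
            (fun _ => hv0.symm) hv hy hyi).symm
      _ = ∑ j ∈ range i, ∑ l ∈ range i,
            B (X l) (h' (v l) (u (v j)) * L (u (y j)) + L (u (v j)) * h' (v l) (u (y j))) :=
          sum_comm
      _ = ∑ j ∈ range i, ∑ l ∈ range i, B (X l + X (l + 1))
            (h' (u (v l)) (u (v j)) * L (u (y j)) + L (u (v j)) * h' (u (v l)) (u (y j))) := by
          refine sum_congr rfl fun j _ => ?_
          exact (sum_range_shift_pairing
            (f := fun a b => B b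
              (h' a (u (v j)) * L (u (y j)) + L (u (v j)) * h' a (u (y j))))
            (a := fun l => u (v l)) (b' := fun l => X l + X (l + 1))
            (fun a a' b => by
              rw [← map_add, map_add h', LinearMap.add_apply, LinearMap.add_apply, add_mul, mul_add]
              congr 1; abel)
            (fun a b b' => by rw [map_add B, LinearMap.add_apply])
            (fun _ => hv0.symm) hv (fun _ => rfl) hXi).symm
      _ = _ := sum_comm

end AbstractWeyl

section Core

open MvPolynomial

variable {k : Type*} [Field k] {A : Type*} [AddCommGroup A] [Module k A]

theorem conj_mul_eq {E : Type*} [AddCommGroup E] [Module k E] (e : E ≃ₗ[k] E)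
    (f f' : Module.End k E) : e.conj (f * f') = e.conj f * e.conj f' :=
  LinearEquiv.conj_comp e f' f

theorem conj_one_eq {E : Type*} [AddCommGroup E] [Module k E] (e : E ≃ₗ[k] E) :
    e.conj (1 : Module.End k E) = 1 := LinearEquiv.conj_id e

theorem conj_map_eq {O : Type*} [AddCommGroup O] [Module k O] (g : O ≃ₗ[k] O) (u : A ≃ₗ[k] A)
    (P : Module.End k O) (f : Module.End k A) :
    (TensorProduct.congr g u).conj (TensorProduct.map P f)
      = TensorProduct.map (g.conj P) (u.conj f) := by
  ext x a
  simp [LinearEquiv.conj_apply]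

/-- The endomorphisms commuting with an automorphism. -/
def conjFixed {E : Type*} [AddCommGroup E] [Module k E] (e : E ≃ₗ[k] E) :
    Submonoid (Module.End k E) where
  carrier := {f | e.conj f = f}
  mul_mem' {f f'} hf hf' := by
    change e.conj (f * f') = f * f'
    rw [conj_mul_eq, show e.conj f = f from hf, show e.conj f' = f' from hf']
  one_mem' := conj_one_eq e

theorem mem_conjFixed {E : Type*} [AddCommGroup E] [Module k E] {e : E ≃ₗ[k] E}
    {f : Module.End k E} : f ∈ conjFixed e ↔ e.conj f = f := Iff.rfl

theorem IsNorm.mul_left {E : Type*} [AddCommGroup E] [Module k E] {e : E ≃ₗ[k] E} {n : ℕ}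
    {f f' : Module.End k E} (hf : f ∈ conjFixed e) (h : IsNorm e.conj.toLinearMap n f') :
    IsNorm e.conj.toLinearMap n (f * f') :=
  h.map (LinearMap.mulLeft k f) fun x => by
    rw [mem_conjFixed] at hf
    simp only [LinearMap.mulLeft_apply, LinearEquiv.coe_coe]
    rw [conj_mul_eq, hf]

theorem IsNorm.mul_right {E : Type*} [AddCommGroup E] [Module k E] {e : E ≃ₗ[k] E} {n : ℕ}
    {f f' : Module.End k E} (hf : f ∈ conjFixed e) (h : IsNorm e.conj.toLinearMap n f') :
    IsNorm e.conj.toLinearMap n (f' * f) :=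
  h.map (LinearMap.mulRight k f) fun x => by
    rw [mem_conjFixed] at hf
    simp only [LinearMap.mulRight_apply, LinearEquiv.coe_coe]
    rw [conj_mul_eq, hf]

/-- The norms for conjugation by an automorphism. -/
def conjNorms {E : Type*} [AddCommGroup E] [Module k E] (e : E ≃ₗ[k] E) (n : ℕ) :
    AddSubgroup (Module.End k E) where
  carrier := {f | IsNorm e.conj.toLinearMap n f}
  add_mem' hf hf' := IsNorm.add hf hf'
  zero_mem' := IsNorm.zero _ _
  neg_mem' hf := IsNorm.neg hf

theorem mem_conjNorms {E : Type*} [AddCommGroup E] [Module k E] {e : E ≃ₗ[k] E} {n : ℕ}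
    {f : Module.End k E} : f ∈ conjNorms e n ↔ IsNorm e.conj.toLinearMap n f := Iff.rfl

variable (k) in
/-- Multiplication by the variables of `k[X₀, …, Xᵢ₋₁]`. -/
noncomputable def mulVar (i l : ℕ) : Module.End k (MvPolynomial (Fin i) k) :=
  LinearMap.mulLeft k (varExt k i l)

theorem mulVar_apply (i l : ℕ) (P : MvPolynomial (Fin i) k) :
    mulVar k i l P = varExt k i l * P := rfl

variable (k) in
/-- The projection of `k[X₀, …, Xᵢ₋₁]` onto the constants. -/
noncomputable def constProj (i : ℕ) : Module.End k (MvPolynomial (Fin i) k) :=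
  Algebra.linearMap k _ ∘ₗ (aeval 0 : MvPolynomial (Fin i) k →ₐ[k] k).toLinearMap

theorem constProj_apply (i : ℕ) (P : MvPolynomial (Fin i) k) :
    constProj k i P = algebraMap k _ (aeval (0 : Fin i → k) P) := rfl

theorem aeval_zero_varExt (i l : ℕ) : aeval (0 : Fin i → k) (varExt k i l) = 0 := by
  unfold varExt
  split_ifs <;> simp

section Shift

variable {i : ℕ} {g : MvPolynomial (Fin i) k ≃ₐ[k] MvPolynomial (Fin i) k}

theorem aeval_zero_shift
    (hg : ∀ l, g (varExt k i l) = varExt k i l + varExt k i (l + 1))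
    (P : MvPolynomial (Fin i) k) :
    aeval (0 : Fin i → k) (g P) = aeval (0 : Fin i → k) P := by
  have : (aeval (0 : Fin i → k)).comp (g : MvPolynomial (Fin i) k →ₐ[k] MvPolynomial (Fin i) k)
      = aeval (0 : Fin i → k) := by
    refine MvPolynomial.algHom_ext fun l => ?_
    have h := hg l
    have h2 := aeval_zero_varExt (k := k) i l
    rw [varExt_of_lt l.2] at h h2
    change aeval (0 : Fin i → k) (g (X l)) = aeval (0 : Fin i → k) (X l)
    rw [h, map_add, aeval_zero_varExt, add_zero]
  exact DFunLike.congr_fun this P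

theorem conj_mulVar
    (hg : ∀ l, g (varExt k i l) = varExt k i l + varExt k i (l + 1))
    (l : ℕ) :
    g.toLinearEquiv.conj (mulVar k i l) = mulVar k i l + mulVar k i (l + 1) := by
  refine LinearMap.ext fun P => ?_
  simp [mulVar, LinearEquiv.conj_apply, hg, add_mul]

theorem conj_constProj (hg : ∀ l, g (varExt k i l) = varExt k i l + varExt k i (l + 1)) :
    g.toLinearEquiv.conj (constProj k i) = constProj k i := by
  refine LinearMap.ext fun P => ?_
  have := aeval_zero_shift hg (g.symm P)
  rw [AlgEquiv.apply_symm_apply] at this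
  change g (algebraMap k _ (aeval (0 : Fin i → k) (g.symm P))) = _
  rw [AlgEquiv.commutes, constProj_apply, this]

theorem pderivExt_zero_eq_conj
    (hg : ∀ l, g (varExt k i l) = varExt k i l + varExt k i (l + 1))
    (h0 : 0 < i) :
    pderivExt k i 0 = g.toLinearEquiv.conj (pderivExt k i 0) := by
  refine LinearMap.ext fun P => ?_
  have := pderivExt_zero_shift h0 hg (g.symm P)
  rw [AlgEquiv.apply_symm_apply] at this
  simpa [LinearEquiv.conj_apply] using this

theorem pderivExt_succ_eq_conj
    (hg : ∀ l, g (varExt k i l) = varExt k i l + varExt k i (l + 1))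
    {l : ℕ} (hl : l + 1 < i) :
    pderivExt k i (l + 1)
      = g.toLinearEquiv.conj (pderivExt k i (l + 1)) + g.toLinearEquiv.conj (pderivExt k i l) := by
  refine LinearMap.ext fun P => ?_
  have := pderivExt_succ_shift hl hg (g.symm P)
  rw [AlgEquiv.apply_symm_apply] at this
  simpa [LinearEquiv.conj_apply] using this

end Shift

theorem pderivExt_mul_mulVar {i j : ℕ} (hj : j < i) (l : ℕ) :
    pderivExt k i j * mulVar k i l
      = mulVar k i l * pderivExt k i j + if j = l then 1 else 0 := by
  refine LinearMap.ext fun P => ?_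
  simp only [mulVar_apply, Module.End.mul_apply, LinearMap.add_apply,
    pderivExt_mul, pderivExt_varExt hj]
  split_ifs <;> simp [add_comm]

theorem pderivExt_mul_constProj (i l : ℕ) : pderivExt k i l * constProj k i = 0 := by
  refine LinearMap.ext fun P => ?_
  rw [Module.End.mul_apply, constProj_apply, MvPolynomial.algebraMap_eq, pderivExt_C,
    LinearMap.zero_apply]

theorem pow_apply_one_tmul_mem_map₂ {i : ℕ} (w : ℕ → Module.End k A) (a : A) (m : ℕ) :
    ((∑ l ∈ range i, TensorProduct.map (mulVar k i l) (w l)) ^ m :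
      Module.End k (MvPolynomial (Fin i) k ⊗[k] A)) (1 ⊗ₜ a) ∈
      Submodule.map₂ (TensorProduct.mk k (MvPolynomial (Fin i) k) A)
        (homogeneousSubmodule (Fin i) k m) ⊤ := by
  induction m with
  | zero => exact Submodule.apply_mem_map₂ _ (isHomogeneous_one _ _) trivial
  | succ m ih =>
    rw [pow_succ', Module.End.mul_apply]
    generalize ((∑ l ∈ range i, TensorProduct.map (mulVar k i l) (w l)) ^ m :
      Module.End k (MvPolynomial (Fin i) k ⊗[k] A)) (1 ⊗ₜ a) = z at ih
    rw [← Submodule.mem_comap]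
    revert z
    rw [← SetLike.le_def, Submodule.map₂_le]
    intro P hP b _
    rw [Submodule.mem_comap, LinearMap.sum_apply]
    refine Submodule.sum_mem _ fun l _ => ?_
    rw [TensorProduct.mk_apply, TensorProduct.map_tmul, mulVar_apply]
    refine Submodule.apply_mem_map₂ _ ?_ trivial
    rw [mem_homogeneousSubmodule] at hP ⊢
    rw [add_comm]
    refine IsHomogeneous.mul ?_ hP
    unfold varExt
    split_ifs
    · exact isHomogeneous_X _ _
    · exact isHomogeneous_zero _ _ _

theorem isNorm_pow_mul_constProj {p : ℕ} [Fact p.Prime] [CharP k p] {i m : ℕ} {u : A ≃ₗ[k] A}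
    {g : MvPolynomial (Fin i) k ≃ₐ[k] MvPolynomial (Fin i) k}
    (hg : ∀ l, g (varExt k i l) = varExt k i l + varExt k i (l + 1)) (hgp : g ^ p = 1)
    (hm : m + i = p + 1) (hm0 : 0 < m) (hmp : m < p) (w : ℕ → Module.End k A)
    (hxS : (∑ l ∈ range i, TensorProduct.map (mulVar k i l) (w l)) ∈
      conjFixed (TensorProduct.congr g.toLinearEquiv u))
    (heS : TensorProduct.map (constProj k i) 1 ∈
      conjFixed (TensorProduct.congr g.toLinearEquiv u)) :
    IsNorm (TensorProduct.congr g.toLinearEquiv u).conj.toLinearMap p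
      ((∑ l ∈ range i, TensorProduct.map (mulVar k i l) (w l) :
        Module.End k (MvPolynomial (Fin i) k ⊗[k] A)) ^ m
        * TensorProduct.map (constProj k i) 1) := by
  obtain ⟨h, hh⟩ := exists_norm_eq_id_on_homogeneousSubmodule hg hgp hm hm0 hmp
  have hQ : IsNorm (TensorProduct.congr g.toLinearEquiv u).conj.toLinearMap p
      ((TensorProduct.mapBilinear (RingHom.id k) _ _ _ _).flip
        (1 : Module.End k A) (∑ c ∈ range p,
          ((g.toLinearEquiv.conj.toLinearMap : Module.End k _) ^ c) h)) :=
    IsNorm.map (T := g.toLinearEquiv.conj.toLinearMap) ⟨h, rfl⟩ _ fun f => by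
      rw [LinearMap.flip_apply, LinearMap.flip_apply, TensorProduct.mapBilinear_apply,
        TensorProduct.mapBilinear_apply, LinearEquiv.coe_coe, LinearEquiv.coe_coe,
        conj_map_eq, conj_one_eq]
  rw [LinearMap.flip_apply, TensorProduct.mapBilinear_apply] at hQ
  generalize ∑ c ∈ range p, ((g.toLinearEquiv.conj.toLinearMap : Module.End k _) ^ c) h = N
    at hQ hh
  have hQm := IsNorm.mul_right (Submonoid.mul_mem _ (Submonoid.pow_mem _ hxS m) heS) hQ
  convert hQm using 1
  refine TensorProduct.ext' fun P a => ?_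
  have he1 : TensorProduct.map (constProj k i) (1 : Module.End k A) (P ⊗ₜ a)
      = (aeval (0 : Fin i → k) P) • (1 ⊗ₜ a) := by
    rw [TensorProduct.map_tmul, constProj_apply, Algebra.algebraMap_eq_smul_one,
      TensorProduct.smul_tmul', Module.End.one_apply]
  rw [Module.End.mul_apply, Module.End.mul_apply, Module.End.mul_apply, he1, map_smul, map_smul]
  congr 1
  have hz := pow_apply_one_tmul_mem_map₂ (i := i) w a m
  generalize ((∑ l ∈ range i, TensorProduct.map (mulVar k i l) (w l) :
        Module.End k (MvPolynomial (Fin i) k ⊗[k] A)) ^ m) (1 ⊗ₜ a) = z at hz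
  change z ∈ LinearMap.eqLocus LinearMap.id (TensorProduct.map N 1)
  revert z
  rw [← SetLike.le_def, Submodule.map₂_le]
  intro P hP b _
  rw [LinearMap.mem_eqLocus, TensorProduct.mk_apply, LinearMap.id_apply, TensorProduct.map_tmul,
    hh P hP, Module.End.one_apply]

variable (k A) in
/-- Compression of an endomorphism of `k[X₀, …, Xᵢ₋₁] ⊗ A` to the constants. -/
noncomputable def compress (i : ℕ) :
    Module.End k (MvPolynomial (Fin i) k ⊗[k] A) →ₗ[k] Module.End k A :=
  (LinearMap.llcomp k A _ A ((TensorProduct.lid k A).toLinearMap ∘ₗ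
      (aeval (0 : Fin i → k)).toLinearMap.rTensor A)) ∘ₗ
    (LinearMap.lcomp k _ (TensorProduct.mk k (MvPolynomial (Fin i) k) A 1))

theorem compress_apply (i : ℕ) (F : Module.End k (MvPolynomial (Fin i) k ⊗[k] A)) (a : A) :
    compress k A i F a = TensorProduct.lid k A
      ((aeval (0 : Fin i → k)).toLinearMap.rTensor A (F (1 ⊗ₜ a))) := rfl

theorem compress_conj {i : ℕ} {u : A ≃ₗ[k] A}
    {g : MvPolynomial (Fin i) k ≃ₐ[k] MvPolynomial (Fin i) k}
    (hg : ∀ l, g (varExt k i l) = varExt k i l + varExt k i (l + 1))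
    (F : Module.End k (MvPolynomial (Fin i) k ⊗[k] A)) :
    compress k A i ((TensorProduct.congr g.toLinearEquiv u).conj F)
      = u.conj (compress k A i F) := by
  refine LinearMap.ext fun a => ?_
  have h1 : (TensorProduct.congr g.toLinearEquiv u).symm (1 ⊗ₜ a) = 1 ⊗ₜ u.symm a := by
    rw [LinearEquiv.symm_apply_eq]
    simp
  have h2 : ∀ z, TensorProduct.lid k A ((aeval (0 : Fin i → k)).toLinearMap.rTensor A
      (TensorProduct.congr g.toLinearEquiv u z))
      = u (TensorProduct.lid k A ((aeval (0 : Fin i → k)).toLinearMap.rTensor A z)) := by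
    intro z
    induction z with
    | zero => simp
    | add z z' hz hz' => simp only [map_add, hz, hz']
    | tmul P b => simp [aeval_zero_shift hg]
  rw [LinearEquiv.conj_apply_apply, compress_apply, compress_apply,
    LinearEquiv.conj_apply_apply, h1, h2]

theorem compress_constProj_mul (i m : ℕ) (D : Module.End k A) :
    compress k A i (TensorProduct.map (constProj k i) 1 * TensorProduct.map 1 D ^ m) = D ^ m := by
  refine LinearMap.ext fun a => ?_
  rw [compress_apply, TensorProduct.map_pow, ← TensorProduct.map_mul]
  simp [constProj_apply]

section

variable {L : A →ₗ[k] Module.End k A} {u : A ≃ₗ[k] A} {i : ℕ} {y v : ℕ → A}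

theorem sum_mul_mem_conjFixed (hL : ∀ a, L (u a) = u.conj (L a))
    (hy : ∀ l, u (y l) = y l + y (l + 1)) (hyi : y i = 0) (hv0 : u (v 0) = v 0)
    (hv : ∀ l, l + 1 < i → v (l + 1) = u (v (l + 1)) + u (v l)) :
    ∑ l ∈ range i, L (v l) * L (y l) ∈ conjFixed u := by
  rw [mem_conjFixed, map_sum]
  simp only [conj_mul_eq, ← hL]
  exact sum_range_shift_pairing (f := fun a b => L a * L b) (a := fun l => u (v l)) (a' := v)
    (by simp [add_mul]) (by simp [mul_add]) (fun _ => hv0.symm) hv hy hyi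

set_option maxHeartbeats 400000 in
theorem isNorm_pow_sum_mul {p : ℕ} [Fact p.Prime] [CharP k p]
    (hL : ∀ a, L (u a) = u.conj (L a))
    (hc : IsNorm (u.arrowCongr (u.arrowCongr u.conj)).toLinearMap p (commutatorMap L))
    {m : ℕ} (hm : m + i = p + 1) (hm0 : 0 < m) (hmp : m < p)
    (hy : ∀ l, u (y l) = y l + y (l + 1)) (hyi : y i = 0) (hv0 : u (v 0) = v 0)
    (hv : ∀ l, l + 1 < i → v (l + 1) = u (v (l + 1)) + u (v l)) :
    IsNorm u.conj.toLinearMap p ((∑ l ∈ range i, L (v l) * L (y l)) ^ m) := by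
  have hD := sum_mul_mem_conjFixed hL hy hyi hv0 hv
  obtain ⟨g, hg, hgp⟩ := exists_shift k i p (by omega)
  have hXi : mulVar k i i = 0 := by
    simp [mulVar, varExt_of_le le_rfl]
  have hxS : (∑ l ∈ range i, TensorProduct.map (mulVar k i l) (L (v l))) ∈
      conjFixed (TensorProduct.congr g.toLinearEquiv u) := by
    rw [mem_conjFixed, map_sum]
    simp only [conj_map_eq, ← hL, conj_mulVar hg]
    exact sum_range_shift_pairing (f := fun a b => TensorProduct.map b (L a))
      (a := fun l => u (v l)) (a' := v) (b' := fun l => mulVar k i l + mulVar k i (l + 1))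
      (by simp [TensorProduct.map_add_right]) (by simp [TensorProduct.map_add_left])
      (fun _ => hv0.symm) hv (fun _ => rfl) hXi
  have hYS : (∑ l ∈ range i, TensorProduct.map (pderivExt k i l) (L (y l))) ∈
      conjFixed (TensorProduct.congr g.toLinearEquiv u) := by
    rw [mem_conjFixed, map_sum]
    simp only [conj_map_eq, ← hL]
    exact sum_range_shift_pairing (f := fun a b => TensorProduct.map a (L b))
      (by simp [TensorProduct.map_add_left]) (by simp [TensorProduct.map_add_right])
      (pderivExt_zero_eq_conj hg) (fun _ => pderivExt_succ_eq_conj hg) hy hyi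
  have hDS : TensorProduct.map 1 (∑ l ∈ range i, L (v l) * L (y l)) ∈
      conjFixed (TensorProduct.congr g.toLinearEquiv u) := by
    rw [mem_conjFixed, conj_map_eq, conj_one_eq, mem_conjFixed.1 hD]
  have heS : TensorProduct.map (constProj k i) 1 ∈
      conjFixed (TensorProduct.congr g.toLinearEquiv u) := by
    rw [mem_conjFixed, conj_map_eq, conj_one_eq, conj_constProj hg]
  have hyx := isNorm_weyl (O := Module.End k (MvPolynomial (Fin i) k))
    (E := Module.End k A) (R := Module.End k (MvPolynomial (Fin i) k ⊗[k] A))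
    (B := TensorProduct.mapBilinear (RingHom.id k) _ _ _ _)
    (gO := g.toLinearEquiv.conj.toLinearMap)
    (gR := (TensorProduct.congr g.toLinearEquiv u).conj.toLinearMap)
    (fun o o' f f' => TensorProduct.map_mul o o' f f') (conj_mul_eq _) (fun P f => conj_map_eq _ _ P f) hc
    (conj_mulVar hg) hXi (pderivExt_zero_eq_conj hg) (fun _ => pderivExt_succ_eq_conj hg)
    (fun _ => pderivExt_mul_mulVar) hy hyi hv0 hv
  have hxD := isNorm_sum_commutator (O := Module.End k (MvPolynomial (Fin i) k))
    (E := Module.End k A) (R := Module.End k (MvPolynomial (Fin i) k ⊗[k] A))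
    (B := TensorProduct.mapBilinear (RingHom.id k) _ _ _ _)
    (gO := g.toLinearEquiv.conj.toLinearMap)
    (gR := (TensorProduct.congr g.toLinearEquiv u).conj.toLinearMap)
    (fun o o' f f' => TensorProduct.map_mul o o' f f') (conj_mul_eq _) hL (fun P f => conj_map_eq _ _ P f) hc
    (conj_mulVar hg) hXi hy hyi hv0 hv
  have hmem := isNorm_pow_mul_constProj hg hgp hm hm0 hmp (fun l => L (v l)) hxS heS
  have hfin := factorial_smul_mem_of_weyl
    (S := conjFixed (TensorProduct.congr g.toLinearEquiv u))
    (I := conjNorms (TensorProduct.congr g.toLinearEquiv u) p)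
    (fun a ha b hb => IsNorm.mul_left ha hb) (fun a ha b hb => IsNorm.mul_right ha hb)
    hxS hYS hDS heS hyx hxD
    (by
      rw [sum_mul]
      refine sum_eq_zero fun l _ => ?_
      rw [← TensorProduct.map_mul, pderivExt_mul_constProj, TensorProduct.map_zero_left])
    (by
      rw [← TensorProduct.map_mul, ← TensorProduct.map_mul, one_mul, mul_one, one_mul, mul_one])
    hmem
  have := (mem_conjNorms.1 hfin).map (T' := u.conj.toLinearMap) (compress k A i)
    (compress_conj hg)
  rw [map_nsmul, compress_constProj_mul, ← Nat.cast_smul_eq_nsmul k] at this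
  have hfac : (m.factorial : k) ≠ 0 := by
    rw [Ne, CharP.cast_eq_zero_iff k p, (Fact.out : p.Prime).dvd_factorial]
    omega
  have := this.smul (m.factorial : k)⁻¹
  rwa [inv_smul_smul₀ hfac] at this

end

end Core

section CharP

variable {k : Type*} [Field k] {A : Type*} [AddCommGroup A] [Module k A]

theorem sub_one_pow_char_pow {p : ℕ} [Fact p.Prime] [CharP k p] (T : Module.End k A) (a : ℕ) :
    (T - 1) ^ p ^ a = T ^ p ^ a - 1 := by
  have : (Polynomial.X - 1 : Polynomial k) ^ p ^ a = Polynomial.X ^ p ^ a - 1 := by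
    rw [sub_pow_char_pow, one_pow]
  simpa using congrArg (Polynomial.aeval T) this

theorem sum_range_pow_eq_sub_one_pow {p : ℕ} [Fact p.Prime] [CharP k p] (T : Module.End k A)
    (a : ℕ) : ∑ j ∈ range (p ^ a), T ^ j = (T - 1) ^ (p ^ a - 1) := by
  have h1 : (Polynomial.X - 1 : Polynomial k) ≠ 0 := by
    simpa using Polynomial.X_sub_C_ne_zero (1 : k)
  have : (∑ j ∈ range (p ^ a), Polynomial.X ^ j : Polynomial k)
      = (Polynomial.X - 1) ^ (p ^ a - 1) := by
    refine mul_right_cancel₀ h1 ?_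
    rw [geom_sum_mul, ← pow_succ, Nat.sub_add_cancel (Nat.one_le_pow _ _ (Fact.out : p.Prime).pos),
      sub_pow_char_pow, one_pow]
  simpa using congrArg (Polynomial.aeval T) this

end CharP

section TraceForm

variable {k : Type*} [Field k] {A : Type*} [AddCommGroup A] [Module k A]

/-- The form `(a, b) ↦ tr (L a * L b)`. -/
noncomputable def traceForm (L : A →ₗ[k] Module.End k A) : A →ₗ[k] A →ₗ[k] k :=
  ((LinearMap.mul k (Module.End k A)).compl₁₂ L L).compr₂ (LinearMap.trace k A)

theorem traceForm_apply (L : A →ₗ[k] Module.End k A) (a b : A) :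
    traceForm L a b = LinearMap.trace k A (L a * L b) := rfl

variable (k A) in
/-- Contraction of the second factor of a tensor with a functional. -/
noncomputable def contractSnd (e : A ⊗[k] A) : (A →ₗ[k] k) →ₗ[k] A :=
  (TensorProduct.rid k A).toLinearMap ∘ₗ LinearMap.applyₗ e ∘ₗ LinearMap.lTensorHom A

theorem contractSnd_apply (e : A ⊗[k] A) (f : A →ₗ[k] k) :
    contractSnd k A e f = TensorProduct.rid k A (f.lTensor A e) := rfl

/-- `a ↦ ∑ xⱼ tr (L yⱼ * L a)` for `e = ∑ xⱼ ⊗ yⱼ`. -/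
noncomputable def casimirMap (L : A →ₗ[k] Module.End k A) (e : A ⊗[k] A) : Module.End k A :=
  contractSnd k A e ∘ₗ (traceForm L).flip

theorem casimirMap_apply (L : A →ₗ[k] Module.End k A) (e : A ⊗[k] A) (a : A) :
    casimirMap L e a = contractSnd k A e ((traceForm L).flip a) := rfl

theorem contractSnd_comp (e : A ⊗[k] A) (f : A →ₗ[k] k) (g : Module.End k A) :
    contractSnd k A e (f ∘ₗ g) = contractSnd k A (g.lTensor A e) f := by
  rw [contractSnd_apply, contractSnd_apply, LinearMap.lTensor_comp, LinearMap.comp_apply]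

theorem contractSnd_rTensor (e : A ⊗[k] A) (f : A →ₗ[k] k) (g : Module.End k A) :
    contractSnd k A (g.rTensor A e) f = g (contractSnd k A e f) := by
  simp only [contractSnd_apply]
  induction e with
  | zero => simp
  | add e e' h h' => simp only [map_add, h, h']
  | tmul a b => simp

variable {L : A →ₗ[k] Module.End k A} {u : A ≃ₗ[k] A} {e : A ⊗[k] A}

theorem traceForm_map (hL : ∀ a, L (u a) = u.conj (L a)) (a b : A) :
    traceForm L (u a) (u b) = traceForm L a b := by
  rw [traceForm_apply, traceForm_apply, hL, hL, ← conj_mul_eq, LinearMap.trace_conj']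

theorem traceForm_symm_sub_one_pow (hL : ∀ a, L (u a) = u.conj (L a)) (j : ℕ) (a b : A) :
    traceForm L (((u.symm.toLinearMap - 1 : Module.End k A) ^ j) a) b
      = traceForm L a (((u.toLinearMap - 1 : Module.End k A) ^ j) b) := by
  induction j generalizing a b with
  | zero => rfl
  | succ j ih =>
    rw [pow_succ, Module.End.mul_apply, ih, pow_succ', Module.End.mul_apply]
    have := traceForm_map hL (u.symm a) (((u.toLinearMap - 1 : Module.End k A) ^ j) b)
    rw [LinearEquiv.apply_symm_apply] at this
    simp [this]

theorem symm_mul_self (u : A ≃ₗ[k] A) :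
    (u.symm.toLinearMap * u.toLinearMap : Module.End k A) = 1 :=
  LinearMap.ext fun a => u.symm_apply_apply a

theorem self_mul_symm (u : A ≃ₗ[k] A) :
    (u.toLinearMap * u.symm.toLinearMap : Module.End k A) = 1 :=
  LinearMap.ext fun a => u.apply_symm_apply a

theorem symm_sub_one_pow_mem_range (i : ℕ) (a : A) :
    ((u.symm.toLinearMap - 1 : Module.End k A) ^ i) a ∈
      LinearMap.range ((u.toLinearMap - 1 : Module.End k A) ^ i) := by
  have h : (u.symm.toLinearMap - 1 : Module.End k A)
      = (u.toLinearMap - 1) * (-u.symm.toLinearMap) := by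
    rw [mul_neg, sub_mul, self_mul_symm, one_mul, neg_sub]
  have hc : Commute (u.toLinearMap - 1 : Module.End k A) (-u.symm.toLinearMap) := by
    rw [Commute, SemiconjBy, ← h, neg_mul, mul_sub, symm_mul_self, mul_one, neg_sub]
  rw [h, hc.mul_pow, Module.End.mul_apply]
  exact LinearMap.mem_range_self _ _

theorem lTensor_sub_one_pow (he : TensorProduct.map u.toLinearMap u.toLinearMap e = e) (i : ℕ) :
    ((u.toLinearMap - 1 : Module.End k A) ^ i).lTensor A e
      = ((u.symm.toLinearMap - 1 : Module.End k A) ^ i).rTensor A e := by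
  have h1 : u.toLinearMap.lTensor A e = u.symm.toLinearMap.rTensor A e := by
    conv_rhs => rw [← he]
    rw [LinearMap.rTensor, LinearMap.lTensor, ← LinearMap.comp_apply, ← TensorProduct.map_comp]
    congr 2
    exact (symm_mul_self u).symm
  induction i with
  | zero => simp [Module.End.one_eq_id]
  | succ i ih =>
    have h2 : (u.toLinearMap - 1 : Module.End k A).lTensor A e
        = (u.symm.toLinearMap - 1 : Module.End k A).rTensor A e := by
      simp [LinearMap.lTensor_sub, LinearMap.rTensor_sub, h1, Module.End.one_eq_id]
    rw [pow_succ', pow_succ, LinearMap.lTensor_mul, LinearMap.rTensor_mul, Module.End.mul_apply,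
      Module.End.mul_apply, ih, ← h2]
    rw [← LinearMap.comp_apply, ← LinearMap.comp_apply, LinearMap.lTensor_comp_rTensor,
      LinearMap.rTensor_comp_lTensor]

theorem exists_comp_eq_of_ker_le (f : A →ₗ[k] k) (g : Module.End k A)
    (h : LinearMap.ker g ≤ LinearMap.ker f) : ∃ f' : A →ₗ[k] k, f = f' ∘ₗ g := by
  have : f ∈ (LinearMap.ker g).dualAnnihilator := by
    rw [Submodule.mem_dualAnnihilator]
    exact fun w hw => h hw
  rw [← LinearMap.range_dualMap_eq_dualAnnihilator_ker] at this
  obtain ⟨f', rfl⟩ := this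
  exact ⟨f', rfl⟩

theorem sum_conj_pow_apply_of_fixed {n : ℕ} (h : Module.End k A) {x : A} (hx : u x = x) :
    (∑ j ∈ range n, ((u.conj.toLinearMap : Module.End k (Module.End k A)) ^ j) h) x
      = (∑ j ∈ range n, (u.toLinearMap : Module.End k A) ^ j) (h x) := by
  rw [LinearMap.sum_apply, LinearMap.sum_apply]
  refine sum_congr rfl fun j _ => ?_
  have := conj_pow_iterate_apply u h j x
  rw [Function.iterate_fixed hx] at this
  rw [this, Module.End.pow_apply]
  rfl

/-- Nondegeneracy of the trace form up to norms. -/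
theorem mem_range_of_traceForm_eq_zero {p : ℕ} [Fact p.Prime] [CharP k p]
    (he : TensorProduct.map u.toLinearMap u.toLinearMap e = e)
    (hΘ : IsNorm u.conj.toLinearMap p (1 - casimirMap L e)) {i : ℕ} (hi : i ≤ p - 1) {x : A}
    (hx : u x = x)
    (h : ∀ v, ((u.toLinearMap - 1 : Module.End k A) ^ i) v = 0 → traceForm L v x = 0) :
    x ∈ LinearMap.range ((u.toLinearMap - 1 : Module.End k A) ^ i) := by
  obtain ⟨h0, hh0⟩ := hΘ
  obtain ⟨f, hf⟩ := exists_comp_eq_of_ker_le ((traceForm L).flip x)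
    ((u.toLinearMap - 1 : Module.End k A) ^ i) fun v hv => h v hv
  have h1 : x = (∑ j ∈ range p, (u.toLinearMap : Module.End k A) ^ j) (h0 x)
      + casimirMap L e x := by
    rw [← sum_conj_pow_apply_of_fixed h0 hx, ← hh0]
    simp
  have h2 := sum_range_pow_eq_sub_one_pow (p := p) (u.toLinearMap : Module.End k A) 1
  rw [pow_one] at h2
  rw [h1, casimirMap_apply, hf, contractSnd_comp, lTensor_sub_one_pow he, contractSnd_rTensor, h2]
  refine Submodule.add_mem _ ?_ (symm_sub_one_pow_mem_range _ _)
  obtain ⟨d, hd⟩ := Nat.exists_eq_add_of_le hi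
  rw [hd, pow_add, Module.End.mul_apply]
  exact LinearMap.mem_range_self _ _

theorem trace_eq_zero_of_isNorm {p : ℕ} [CharP k p]
    {f : Module.End k A} (hf : IsNorm u.conj.toLinearMap p f) : LinearMap.trace k A f = 0 :=
  (hf.map (T' := 1) (LinearMap.trace k A) fun h => LinearMap.trace_conj' h u).eq_zero
    (CharP.cast_eq_zero k p)

variable [FiniteDimensional k A]

theorem traceForm_eq_zero {p : ℕ} [Fact p.Prime] [CharP k p]
    (hL : ∀ a, L (u a) = u.conj (L a))
    (hc : IsNorm (u.arrowCongr (u.arrowCongr u.conj)).toLinearMap p (commutatorMap L))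
    {i : ℕ} (hi : 2 ≤ i) (hip : i ≤ p - 1) {y v : A}
    (hy : ((u.toLinearMap - 1 : Module.End k A) ^ i) y = 0)
    (hv : ((u.toLinearMap - 1 : Module.End k A) ^ i) v = 0) :
    traceForm L v (((u.toLinearMap - 1 : Module.End k A) ^ (i - 1)) y) = 0 := by
  set s : Module.End k A := u.toLinearMap - 1 with hs
  set s' : Module.End k A := u.symm.toLinearMap - 1 with hs'
  have hsu : ∀ a, u a = a + s a := fun a => by simp [hs]
  have hsu' : ∀ a, a = u a + u (s' a) := fun a => by simp [hs']
  have hv' : (s' ^ i) v = 0 := by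
    have h : s' = -(u.symm.toLinearMap * s) := by
      rw [hs, mul_sub, symm_mul_self, hs', mul_one, neg_sub]
    have hcm : Commute (-u.symm.toLinearMap : Module.End k A) s := by
      rw [Commute, SemiconjBy, hs, neg_mul, mul_sub, symm_mul_self, mul_neg, sub_mul,
        self_mul_symm, one_mul, mul_one]
    rw [h, ← neg_mul, hcm.mul_pow, Module.End.mul_apply, hv, map_zero]
  have hyl : ∀ l, u ((s ^ l) y) = (s ^ l) y + (s ^ (l + 1)) y := fun l => by
    rw [hsu, pow_succ', Module.End.mul_apply]
  have hv0 : u ((s' ^ (i - 1 - 0)) v) = (s' ^ (i - 1 - 0)) v := by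
    have h1 := hsu' ((s' ^ (i - 1 - 0)) v)
    rw [← Module.End.mul_apply s', ← pow_succ', show i - 1 - 0 + 1 = i by omega, hv', map_zero,
      add_zero] at h1
    exact h1.symm
  have hvl : ∀ l, l + 1 < i → (s' ^ (i - 1 - (l + 1))) v
      = u ((s' ^ (i - 1 - (l + 1))) v) + u ((s' ^ (i - 1 - l)) v) := by
    intro l hl
    rw [show i - 1 - l = i - 1 - (l + 1) + 1 by omega, pow_succ', Module.End.mul_apply]
    exact hsu' _
  have hD := sum_mul_mem_conjFixed (y := fun l => (s ^ l) y) (v := fun l => (s' ^ (i - 1 - l)) v)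
    hL hyl hy hv0 hvl
  have hN := isNorm_pow_sum_mul (y := fun l => (s ^ l) y) (v := fun l => (s' ^ (i - 1 - l)) v)
    (m := p + 1 - i) hL hc (by omega) (by omega) (by omega) hyl hy hv0 hvl
  set D := ∑ l ∈ range i, L ((s' ^ (i - 1 - l)) v) * L ((s ^ l) y) with hDdef
  have htr : LinearMap.trace k A D = i * traceForm L v ((s ^ (i - 1)) y) := by
    rw [hDdef, map_sum, sum_congr rfl (g := fun _ => traceForm L v ((s ^ (i - 1)) y)), sum_const,
      card_range, nsmul_eq_mul]
    intro l hl
    rw [mem_range] at hl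
    rw [← traceForm_apply, traceForm_symm_sub_one_pow hL, ← hs, ← Module.End.mul_apply, ← pow_add,
      show i - 1 - l + l = i - 1 by omega]
  have hDp : IsNorm u.conj.toLinearMap p (D ^ p) := by
    have := IsNorm.mul_left (Submonoid.pow_mem _ hD (i - 1)) hN
    rwa [← pow_add, show i - 1 + (p + 1 - i) = p by omega] at this
  have h0 : LinearMap.trace k A D = 0 := by
    have := LinearMap.trace_pow_char p D
    rw [trace_eq_zero_of_isNorm hDp] at this
    exact pow_eq_zero_iff (Fact.out : p.Prime).ne_zero |>.1 this.symm
  rw [htr] at h0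
  refine (mul_eq_zero.1 h0).resolve_left ?_
  rw [CharP.cast_eq_zero_iff k p]
  exact fun hd => by have := Nat.le_of_dvd (by omega) hd; omega

theorem mem_range_sub_one_pow {p : ℕ} [Fact p.Prime] [CharP k p]
    (hL : ∀ a, L (u a) = u.conj (L a))
    (hc : IsNorm (u.arrowCongr (u.arrowCongr u.conj)).toLinearMap p (commutatorMap L))
    (he : TensorProduct.map u.toLinearMap u.toLinearMap e = e)
    (hΘ : IsNorm u.conj.toLinearMap p (1 - casimirMap L e)) {x : A} (hx : u x = x)
    (hx1 : x ∈ LinearMap.range (u.toLinearMap - 1 : Module.End k A)) :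
    x ∈ LinearMap.range ((u.toLinearMap - 1 : Module.End k A) ^ (p - 1)) := by
  have hp := (Fact.out : p.Prime).two_le
  have : ∀ i, 1 ≤ i → i ≤ p - 1 →
      x ∈ LinearMap.range ((u.toLinearMap - 1 : Module.End k A) ^ i) := by
    intro i hi
    induction i, hi using Nat.le_induction with
    | base => simpa using fun _ => hx1
    | succ i hi ih =>
      intro hip
      obtain ⟨y, rfl⟩ := ih (by omega)
      refine mem_range_of_traceForm_eq_zero he hΘ hip hx fun v hv => ?_
      refine traceForm_eq_zero (i := i + 1) hL hc (by omega) hip ?_ hv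
      rw [pow_succ', Module.End.mul_apply, LinearMap.sub_apply]
      exact sub_eq_zero.2 hx
  exact this _ (by omega) le_rfl

end TraceForm

section StableRing

variable {k : Type*} [Field k] {A : Type*} [AddCommGroup A] [Module k A]

/-- The associator of a multiplication. -/
noncomputable def associatorMap (L : A →ₗ[k] Module.End k A) : A →ₗ[k] A →ₗ[k] Module.End k A :=
  LinearMap.compr₂ L L - (LinearMap.mul k (Module.End k A)).compl₁₂ L L

theorem associatorMap_apply (L : A →ₗ[k] Module.End k A) (a b : A) :
    associatorMap L a b = L (L a b) - L a * L b := rfl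

/-- A multiplication `L` and a tensor `e`, invariant under `γ` and satisfying the axioms of
a commutative separable algebra up to norms. -/
structure IsNormRing (γ : A ≃ₗ[k] A) (q : ℕ) (L : A →ₗ[k] Module.End k A) (e : A ⊗[k] A) :
    Prop where
  map_conj : ∀ a, L (γ a) = γ.conj (L a)
  map_elt : TensorProduct.map γ.toLinearMap γ.toLinearMap e = e
  commutator : IsNorm (γ.arrowCongr (γ.arrowCongr γ.conj)).toLinearMap q (commutatorMap L)
  associator : IsNorm (γ.arrowCongr (γ.arrowCongr γ.conj)).toLinearMap q (associatorMap L)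
  swap : IsNorm (γ.arrowCongr γ.conj).toLinearMap q (L.flip - L : A →ₗ[k] Module.End k A)
  casimir : IsNorm γ.conj.toLinearMap q (1 - casimirMap L e)

theorem toLinearMap_pow (γ : A ≃ₗ[k] A) (r : ℕ) :
    (γ ^ r).toLinearMap = (γ.toLinearMap : Module.End k A) ^ r := by
  induction r with
  | zero => rfl
  | succ r ih => rw [pow_succ, pow_succ, ← ih]; rfl

theorem IsNorm.linearEquiv_pow {δ : A ≃ₗ[k] A} {m r : ℕ} {x : A}
    (hx : IsNorm δ.toLinearMap (m * r) x) : IsNorm (δ ^ r).toLinearMap m x := by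
  rw [toLinearMap_pow]
  exact hx.of_mul

theorem arrowCongr_pow {E : Type*} [AddCommGroup E] [Module k E] (γ : A ≃ₗ[k] A)
    (δ : E ≃ₗ[k] E) (r : ℕ) :
    (γ ^ r).arrowCongr (δ ^ r) = (γ.arrowCongr δ : (A →ₗ[k] E) ≃ₗ[k] (A →ₗ[k] E)) ^ r := by
  induction r with
  | zero => rfl
  | succ r ih =>
    rw [pow_succ, pow_succ, pow_succ, ← ih]
    ext f a
    simp only [LinearEquiv.mul_apply, LinearEquiv.arrowCongr_apply]
    rfl

theorem conj_linearEquiv_pow (γ : A ≃ₗ[k] A) (r : ℕ) : (γ ^ r).conj = γ.conj ^ r := arrowCongr_pow γ γ r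

theorem IsNormRing.pow {γ : A ≃ₗ[k] A} {q r : ℕ} {L : A →ₗ[k] Module.End k A} {e : A ⊗[k] A}
    (h : IsNormRing γ (q * r) L e) : IsNormRing (γ ^ r) q L e where
  map_conj a := by
    rw [conj_linearEquiv_pow]
    induction r with
    | zero => rfl
    | succ r ih =>
      have : ∀ j a, L ((γ ^ j) a) = (γ.conj ^ j) (L a) := by
        intro j
        induction j with
        | zero => exact fun _ => rfl
        | succ j ih' =>
          intro a
          rw [pow_succ', pow_succ', LinearEquiv.mul_apply, LinearEquiv.mul_apply, h.map_conj, ih']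
      exact this _ _
  map_elt := by
    rw [toLinearMap_pow, ← TensorProduct.map_pow]
    induction r with
    | zero => rfl
    | succ r ih =>
      have : ∀ j, ((TensorProduct.map γ.toLinearMap γ.toLinearMap :
          Module.End k (A ⊗[k] A)) ^ j) e = e := by
        intro j
        rw [Module.End.pow_apply]
        exact Function.iterate_fixed h.map_elt j
      exact this _
  commutator := by
    rw [conj_linearEquiv_pow, arrowCongr_pow, arrowCongr_pow]
    exact h.commutator.linearEquiv_pow
  associator := by
    rw [conj_linearEquiv_pow, arrowCongr_pow, arrowCongr_pow]
    exact h.associator.linearEquiv_pow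
  swap := by
    rw [conj_linearEquiv_pow, arrowCongr_pow]
    exact h.swap.linearEquiv_pow
  casimir := by
    rw [conj_linearEquiv_pow]
    exact h.casimir.linearEquiv_pow

theorem IsNorm.apply_fixed {E : Type*} [AddCommGroup E] [Module k E] {u : A ≃ₗ[k] A}
    {δ : E ≃ₗ[k] E} {q : ℕ} {F : A →ₗ[k] E} (hF : IsNorm (u.arrowCongr δ).toLinearMap q F) {a : A}
    (ha : u a = a) : IsNorm δ.toLinearMap q (F a) :=
  hF.map (LinearMap.applyₗ a) fun h => by
    have : u.symm a = a := by rw [LinearEquiv.symm_apply_eq, ha]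
    simp [LinearEquiv.arrowCongr_apply, this]

theorem IsNorm.mem_range {p : ℕ} [Fact p.Prime] [CharP k p] {T : Module.End k A} {a : ℕ} {x : A}
    (h : IsNorm T (p ^ a) x) : x ∈ LinearMap.range ((T - 1) ^ (p ^ a - 1)) := by
  obtain ⟨y, rfl⟩ := h
  rw [← LinearMap.sum_apply, sum_range_pow_eq_sub_one_pow]
  exact LinearMap.mem_range_self _ _

theorem IsNormRing.mem_conjFixed {u : A ≃ₗ[k] A} {q : ℕ} {L : A →ₗ[k] Module.End k A}
    {e : A ⊗[k] A} (h : IsNormRing u q L e) {a : A} (ha : u a = a) :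
    L a ∈ conjFixed u := by
  rw [_root_.mem_conjFixed, ← h.map_conj, ha]

theorem IsNormRing.map_mul {u : A ≃ₗ[k] A} {q : ℕ} {L : A →ₗ[k] Module.End k A}
    {e : A ⊗[k] A} (h : IsNormRing u q L e) (a b : A) :
    u (L a b) = L (u a) (u b) := by
  rw [h.map_conj, LinearEquiv.conj_apply_apply, LinearEquiv.symm_apply_apply]

end StableRing

section CharTwo

variable {k : Type*} [Field k] [CharP k 2] {A : Type*} [AddCommGroup A] [Module k A]
  {γ u : A ≃ₗ[k] A} {L : A →ₗ[k] Module.End k A} {e : A ⊗[k] A}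

theorem traceForm_mul_self [FiniteDimensional k A] (h : IsNormRing u 2 L e) {a v : A}
    (ha : u a = a) (hv : u v = v) :
    traceForm L (L v v) (L a a) = traceForm L v a ^ 2 := by
  have h1 := (h.associator.apply_fixed hv).apply_fixed hv
  have h2 := (h.associator.apply_fixed ha).apply_fixed ha
  have h3 := (h.commutator.apply_fixed hv).apply_fixed ha
  rw [associatorMap_apply] at h1 h2
  rw [commutatorMap_apply] at h3
  have hLv := h.mem_conjFixed hv
  have hLa := h.mem_conjFixed ha
  have hLaa : L (L a a) ∈ conjFixed u := h.mem_conjFixed (by rw [h.map_mul, ha])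
  have t1 := trace_eq_zero_of_isNorm (h1.mul_right hLaa)
  have t2 := trace_eq_zero_of_isNorm (h2.mul_left (Submonoid.mul_mem _ hLv hLv))
  have t3 := trace_eq_zero_of_isNorm ((h3.mul_left hLv).mul_right hLa)
  rw [traceForm_apply, traceForm_apply, ← LinearMap.trace_pow_char 2]
  have : L (L v v) * L (L a a) = (L (L v v) - L v * L v) * L (L a a)
      + L v * L v * (L (L a a) - L a * L a) + L v * (L v * L a - L a * L v) * L a
      + (L v * L a) ^ 2 := by
    noncomm_ring
  rw [this, map_add, map_add, map_add, t1, t2, t3, zero_add, zero_add, zero_add]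

/-- Squares of the elements fixed by `u` that are fixed by `γ` modulo `u - 1`. -/
theorem exists_mul_self_eq {r' : ℕ} (h : IsNormRing γ (2 ^ (r' + 1)) L e)
    (hu : u = γ ^ 2 ^ r') (huu : u * u = 1) {a y : A} (ha : u a = a)
    (hay : γ a = a + (u y - y)) :
    ∃ c w, γ c = c ∧ L a a = c + (u w - w) := by
  have hC : IsNormRing u 2 L e := by
    rw [hu]
    rw [pow_succ'] at h
    exact h.pow
  have two : ∀ z : A, z + z = 0 := fun z => by
    rw [← two_smul k z, show (2 : k) = 0 by exact_mod_cast CharP.cast_eq_zero k 2, zero_smul]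
  have hneg : ∀ z w : A, z - w = z + w := fun z w => by
    rw [sub_eq_iff_eq_add, add_assoc, two, add_zero]
  set r := 2 ^ r' with hr
  set Y : ℕ → A := fun j => (γ ^ j) y with hY
  set P : ℕ → A := fun j => ∑ l ∈ range j, Y l with hP
  set b : ℕ → A := fun N => ∑ j ∈ range N, L (P j) (Y j) with hb
  have hYs : ∀ j, γ (Y j) = Y (j + 1) := fun j => by
    simp only [hY, pow_succ', LinearEquiv.mul_apply]
  have hYr : ∀ j, Y (r + j) = u (Y j) := fun j => by
    simp only [hY, pow_add, hu, LinearEquiv.mul_apply]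
  have hY0 : Y 0 = y := rfl
  have hPs : ∀ j, P (j + 1) = γ (P j) + Y 0 := fun j => by
    simp only [hP, map_sum, hYs]
    exact sum_range_succ' _ _
  have hPr : ∀ j, P (r + j) = P r + u (P j) := fun j => by
    simp only [hP, map_sum, sum_range_add, hYr]
  have hPs' : ∀ j, P (j + 1) = P j + Y j := fun j => sum_range_succ _ _
  have ha0 : γ (a - P r) = a - P r := by
    have h1 := hPs r
    rw [hPs', ← add_zero r, hYr, add_zero, hY0] at h1
    rw [map_sub, hay, eq_sub_of_add_eq h1.symm]
    abel
  have hγu : ∀ z, γ z = z → u z = z := fun z hz => by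
    rw [hu]
    have : ∀ j, (γ ^ j) z = z := fun j => by
      induction j with
      | zero => rfl
      | succ j ih => rw [pow_succ', LinearEquiv.mul_apply, ih, hz]
    exact this _
  have hua0 := hγu _ ha0
  have hPu : u (P r) = P r := by
    rw [map_sub, ha] at hua0
    exact sub_right_injective hua0
  have hP2 : P (r + r) = 0 := by rw [hPr, hPu, two]
  have hY2 : Y (r + r) = Y 0 := by
    rw [hYr, ← add_zero r, hYr, ← LinearEquiv.mul_apply, huu]
    rfl
  have hbγ : γ (b (r + r)) = b (r + r) := by
    have h1 : ∀ j, γ (L (P j) (Y j)) = L (P (j + 1)) (Y (j + 1)) - L (Y 0) (γ (Y j)) := fun j => by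
      rw [h.map_mul, hPs, map_add, LinearMap.add_apply, hYs, add_sub_cancel_right]
    have h2 : ∑ j ∈ range (r + r), L (P (j + 1)) (Y (j + 1)) = b (r + r) := by
      have := sum_range_succ' (fun j => L (P j) (Y j)) (r + r)
      rw [sum_range_succ, hP2, show P 0 = 0 from rfl, map_zero, LinearMap.zero_apply,
        LinearMap.zero_apply, add_zero, add_zero] at this
      exact this.symm
    have h3 : ∑ j ∈ range (r + r), L (Y 0) (γ (Y j)) = 0 := by
      rw [← map_sum, ← map_sum]
      change L (Y 0) (γ (P (r + r))) = 0
      rw [hP2, map_zero, map_zero]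
    rw [show γ (b (r + r)) = ∑ j ∈ range (r + r), γ (L (P j) (Y j)) from map_sum _ _ _,
      sum_congr rfl fun j _ => h1 j, sum_sub_distrib, h2, h3, sub_zero]
  have hbr : b (r + r) = b r + (L (P r) (P r) + u (b r)) := by
    have h1 : ∀ j, L (P (r + j)) (Y (r + j)) = L (P r) (u (Y j)) + u (L (P j) (Y j)) := fun j => by
      rw [hPr, hYr, map_add, LinearMap.add_apply, hC.map_mul]
    rw [show b (r + r) = b r + ∑ j ∈ range r, L (P (r + j)) (Y (r + j)) from sum_range_add _ _ _,
      sum_congr rfl fun j _ => h1 j, sum_add_distrib, ← map_sum, ← map_sum, ← map_sum u]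
    change b r + (L (P r) (u (P r)) + _) = _
    rw [hPu]
  have hsw : ∃ z, L (a - P r) (P r) + L (P r) (a - P r) = u z - z := by
    have h1 := (hC.swap.apply_fixed hPu).apply_fixed hua0
    rw [← pow_one 2] at h1
    obtain ⟨z, hz⟩ := h1.mem_range
    refine ⟨z, ?_⟩
    rw [← hneg]
    simpa using hz.symm
  obtain ⟨z, hz⟩ := hsw
  refine ⟨L (a - P r) (a - P r) + b (r + r), z + b r, ?_, ?_⟩
  · rw [map_add, hbγ, h.map_mul, ha0]
  · have h1 : L (P r) (P r) = b (r + r) + (u (b r) - b r) := by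
      rw [hbr, hneg (u (b r))]
      have := two (b r)
      have h3 := two (u (b r))
      rw [show b r + (L (P r) (P r) + u (b r)) + (u (b r) + b r)
        = L (P r) (P r) + (b r + b r) + (u (b r) + u (b r)) by abel, this, h3, add_zero, add_zero]
    have h2 : L a a = L (a - P r) (a - P r) + (L (a - P r) (P r) + L (P r) (a - P r))
        + L (P r) (P r) := by
      simp only [map_sub, LinearMap.sub_apply]
      abel
    rw [h2, hz, h1, map_add]
    abel

end CharTwo

section CharTwo

variable {k : Type*} [Field k] [CharP k 2] {A : Type*} [AddCommGroup A] [Module k A]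
  {γ u : A ≃ₗ[k] A} {L : A →ₗ[k] Module.End k A} {e : A ⊗[k] A}

/-- The trace form separates the fixed vectors modulo the image of `u - 1`. -/
theorem exists_traceForm_eq {V : Type*} [AddCommGroup V] [Module k V] {ι : Type*} [Fintype ι]
    [DecidableEq ι] (h : IsNormRing u 2 L e) (π : A →ₗ[k] V)
    (hπ : LinearMap.range (u.toLinearMap - 1 : Module.End k A) ≤ LinearMap.ker π) {a : ι → A}
    (ha : ∀ i, u (a i) = a i) (hli : LinearIndependent k fun i => π (a i)) (j : ι) :
    ∃ v, u v = v ∧ ∀ i, traceForm L v (a i) = if i = j then 1 else 0 := by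
  set s : Module.End k A := u.toLinearMap - 1 with hs
  have hsk : ∀ v, v ∈ LinearMap.ker s ↔ u v = v := fun v => by
    simp [hs, sub_eq_zero]
  let F : LinearMap.ker s →ₗ[k] (ι → k) :=
    LinearMap.pi fun i => ((traceForm L).flip (a i)) ∘ₗ (LinearMap.ker s).subtype
  have hF : LinearMap.range F = ⊤ := by
    by_contra hne
    obtain ⟨f, hf0, hf⟩ := Submodule.exists_le_ker_of_lt_top _ (lt_top_iff_ne_top.2 hne)
    refine hf0 ?_
    have hfs : ∀ g : ι → k, f g = ∑ i, g i * f (Pi.single i 1) := fun g => by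
      rw [LinearMap.pi_apply_eq_sum_univ f g]
      refine sum_congr rfl fun i _ => ?_
      rw [smul_eq_mul]
      congr 2
      ext l
      simp [Pi.single_apply, eq_comm]
    have hx : ∑ i, f (Pi.single i 1) • a i ∈ LinearMap.range (s ^ 1) := by
      refine mem_range_of_traceForm_eq_zero (p := 2) h.map_elt h.casimir le_rfl ?_ fun v hv => ?_
      · simp only [map_sum, map_smul, ha]
      · have h1 : F ⟨v, hv⟩ ∈ LinearMap.ker f := hf (LinearMap.mem_range_self _ _)
        rw [LinearMap.mem_ker, hfs] at h1
        rw [← h1, map_sum]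
        refine sum_congr rfl fun i _ => ?_
        rw [map_smul, smul_eq_mul, mul_comm]
        rfl
    rw [pow_one] at hx
    have h2 : ∑ i, f (Pi.single i 1) • π (a i) = 0 := by
      have := hπ hx
      simpa only [LinearMap.mem_ker, map_sum, map_smul] using this
    have h3 := Fintype.linearIndependent_iff.1 hli _ h2
    refine LinearMap.ext fun g => ?_
    rw [hfs]
    simp [h3]
  obtain ⟨⟨v, hv⟩, hvF⟩ := LinearMap.range_eq_top.1 hF (Pi.single j 1)
  refine ⟨v, (hsk v).1 hv, fun i => ?_⟩
  have := congrFun hvF i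
  rw [Pi.single_apply] at this
  exact this

variable [FiniteDimensional k A]

theorem linearIndependent_mul_self {V : Type*} [AddCommGroup V] [Module k V] {ι : Type*}
    [Fintype ι] (h : IsNormRing u 2 L e) (π : A →ₗ[k] V)
    (hπ : LinearMap.range (u.toLinearMap - 1 : Module.End k A) = LinearMap.ker π) {a : ι → A}
    (ha : ∀ i, u (a i) = a i) (hli : LinearIndependent k fun i => π (a i)) :
    LinearIndependent k fun i => π (L (a i) (a i)) := by
  classical
  rw [Fintype.linearIndependent_iff]
  intro c hc j
  obtain ⟨v, hv, hva⟩ := exists_traceForm_eq h π hπ.le ha hli j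
  have h1 : ∑ i, c i • L (a i) (a i) ∈ LinearMap.range (u.toLinearMap - 1 : Module.End k A) := by
    rw [hπ, LinearMap.mem_ker]
    simpa only [map_sum, map_smul] using hc
  obtain ⟨z, hz⟩ := h1
  have h2 := traceForm_symm_sub_one_pow h.map_conj 1 (L v v) z
  have h3 : u.symm (L v v) = L v v := by
    rw [LinearEquiv.symm_apply_eq, h.map_mul, hv]
  rw [pow_one, pow_one, hz] at h2
  simpa [h3, traceForm_mul_self h (ha _) hv, hva] using h2.symm

theorem mem_ker_sup_range {r' : ℕ} (h : IsNormRing γ (2 ^ (r' + 1)) L e)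
    (hu : u = γ ^ 2 ^ r') (huu : u * u = 1) {a y : A} (ha : u a = a)
    (hay : γ a = a + (u y - y)) :
    a ∈ LinearMap.ker (γ.toLinearMap - 1 : Module.End k A) ⊔
      LinearMap.range (u.toLinearMap - 1 : Module.End k A) := by
  have hC : IsNormRing u 2 L e := by
    rw [hu]
    rw [pow_succ'] at h
    exact h.pow
  set s : Module.End k A := u.toLinearMap - 1 with hs
  set t : Module.End k A := γ.toLinearMap - 1 with ht
  have hst : s = t ^ 2 ^ r' := by
    rw [ht, sub_one_pow_char_pow, ← toLinearMap_pow, hs, hu]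
  have hss : s * s = 0 := by
    rw [← pow_two, ← pow_one 2, hs, sub_one_pow_char_pow, pow_one, ← toLinearMap_pow, pow_two, huu]
    exact sub_self _
  have hpos : 0 < 2 ^ r' := Nat.two_pow_pos r'
  have hker : LinearMap.ker t ≤ LinearMap.ker s := by
    intro x hx
    rw [hst, ← Nat.sub_add_cancel hpos, pow_succ]
    rw [LinearMap.mem_ker] at hx ⊢
    rw [Module.End.mul_apply, hx, map_zero]
  set V : Submodule k A := LinearMap.ker s ⊓ (LinearMap.range s).comap t with hV
  set S : Submodule k A := LinearMap.ker t ⊔ LinearMap.range s with hS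
  have hSV : S ≤ V := by
    refine sup_le (le_inf hker fun x hx => ?_) (le_inf ?_ ?_)
    · rw [Submodule.mem_comap, LinearMap.mem_ker.1 hx]
      exact zero_mem _
    · rintro _ ⟨x, rfl⟩
      exact LinearMap.congr_fun hss x
    · rintro _ ⟨x, rfl⟩
      refine ⟨t x, ?_⟩
      rw [← Module.End.mul_apply, ← Module.End.mul_apply, hst, ← pow_succ, ← pow_succ']
  set π := (LinearMap.range s).mkQ with hπ
  have hπk : LinearMap.ker π = LinearMap.range s := Submodule.ker_mkQ _
  have haV : a ∈ V := by
    refine ⟨by simp [hs, ha], y, ?_⟩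
    simp [hs, ht, hay]
  have hrank : V.map π = S.map π := by
    refine (Submodule.eq_of_le_of_finrank_le (Submodule.map_mono hSV) ?_).symm
    let b := Module.finBasis k (V.map π)
    have hb : ∀ i, ∃ a ∈ V, π a = b i := fun i => (b i).2
    choose a haV hab using hb
    have hau : ∀ i, u (a i) = a i := fun i => by
      have := (haV i).1
      simpa [hs, sub_eq_zero] using this
    have hli : LinearIndependent k fun i => π (a i) := by
      simp only [hab]
      exact b.linearIndependent.map' (V.map π).subtype (Submodule.ker_subtype _)
    have hw : ∀ i, π (L (a i) (a i)) ∈ S.map π := fun i => by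
      obtain ⟨y, hy⟩ := (haV i).2
      obtain ⟨c, w, hc, hcw⟩ := exists_mul_self_eq h hu huu (hau i) (y := y) (by
        have : t (a i) = γ (a i) - a i := rfl
        have h2 : s y = u y - y := rfl
        rw [← h2, hy, this, add_sub_cancel])
      refine Submodule.mem_map_of_mem ?_
      rw [hcw]
      refine add_mem (Submodule.mem_sup_left ?_) (Submodule.mem_sup_right ⟨w, rfl⟩)
      simp [ht, hc]
    have hli2 : LinearIndependent k fun i => (⟨π (L (a i) (a i)), hw i⟩ : S.map π) :=
      LinearIndependent.of_comp (S.map π).subtype (linearIndependent_mul_self hC π hπk.symm hau hli)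
    simpa using hli2.fintype_card_le_finrank
  have : π a ∈ S.map π := hrank ▸ Submodule.mem_map_of_mem haV
  obtain ⟨c, hc, hca⟩ := this
  have h1 : a - c ∈ LinearMap.range s := by
    rw [← hπk, LinearMap.mem_ker, map_sub, hca, sub_self]
  rw [← add_sub_cancel c a]
  exact add_mem hc (Submodule.mem_sup_right h1)

theorem mem_range_sub_one_pow_two {r' : ℕ} (h : IsNormRing γ (2 ^ (r' + 1)) L e)
    (hγ : γ ^ 2 ^ (r' + 1) = 1) {x : A} (hx : γ x = x)
    (hxs : x ∈ LinearMap.range ((γ.toLinearMap - 1 : Module.End k A) ^ 2 ^ r')) :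
    x ∈ LinearMap.range ((γ.toLinearMap - 1 : Module.End k A) ^ (2 ^ (r' + 1) - 1)) := by
  set t : Module.End k A := γ.toLinearMap - 1 with ht
  set u : A ≃ₗ[k] A := γ ^ 2 ^ r' with hu
  have huu : u * u = 1 := by
    rw [hu, ← pow_add, ← two_mul, ← pow_succ', hγ]
  have hst : (u.toLinearMap - 1 : Module.End k A) = t ^ 2 ^ r' := by
    rw [ht, sub_one_pow_char_pow, ← toLinearMap_pow, hu]
  have hpos : 0 < 2 ^ r' := Nat.two_pow_pos r'
  have htx : t x = 0 := by simp [ht, hx]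
  have : ∀ l, l ≤ 2 ^ r' - 1 → x ∈ LinearMap.range (t ^ (2 ^ r' + l)) := by
    intro l
    induction l with
    | zero => exact fun _ => hxs
    | succ l ih =>
      intro hl
      obtain ⟨y, hy⟩ := ih (by omega)
      have hta : t ((t ^ (2 ^ r' - 1)) y) = (t ^ 2 ^ r') y := by
        rw [← Module.End.mul_apply, ← pow_succ', Nat.sub_add_cancel hpos]
      have hta' : ∀ m, (t ^ (m + 1)) ((t ^ (2 ^ r' - 1)) y) = (t ^ (2 ^ r' + m)) y := by
        intro m
        rw [pow_succ, Module.End.mul_apply, hta, ← Module.End.mul_apply, ← pow_add, add_comm]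
      have ha : u ((t ^ (2 ^ r' - 1)) y) = (t ^ (2 ^ r' - 1)) y := by
        rw [← sub_eq_zero]
        change (u.toLinearMap - 1 : Module.End k A) _ = 0
        rw [hst, show 2 ^ r' = (2 ^ r' - 1 - (l + 1)) + 1 + (l + 1) by omega, pow_add,
          Module.End.mul_apply, ← show 2 ^ r' = (2 ^ r' - 1 - (l + 1)) + 1 + (l + 1) by omega,
          hta', hy, pow_succ, Module.End.mul_apply, htx, map_zero]
      have hmem := mem_ker_sup_range h hu huu ha (y := y) (by
        have h1 : u y - y = (t ^ 2 ^ r') y := by rw [← hst]; rfl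
        rw [h1, ← hta]
        simp [ht])
      obtain ⟨c, hc, _, ⟨z, rfl⟩, hcz⟩ := Submodule.mem_sup.1 hmem
      refine ⟨z, ?_⟩
      rw [← hy, ← hta', ← hcz, map_add, hst, pow_succ, Module.End.mul_apply,
        LinearMap.mem_ker.1 hc, map_zero, zero_add, ← pow_succ, ← Module.End.mul_apply, ← pow_add]
      congr 2
      omega
  have h2 := this _ le_rfl
  rwa [show 2 ^ r' + (2 ^ r' - 1) = 2 ^ (r' + 1) - 1 by rw [pow_succ]; omega] at h2

end CharTwo

section General

variable {k : Type*} [Field k] {A : Type*} [AddCommGroup A] [Module k A]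
  [FiniteDimensional k A] {γ : A ≃ₗ[k] A} {L : A →ₗ[k] Module.End k A} {e : A ⊗[k] A}

theorem mem_range_sub_one_pow_of_odd {p : ℕ} [Fact p.Prime] [CharP k p] (hp : 3 ≤ p) {r' : ℕ}
    (h : IsNormRing γ (p ^ (r' + 1)) L e) {x : A} (hx : γ x = x)
    (hxs : x ∈ LinearMap.range ((γ.toLinearMap - 1 : Module.End k A) ^ p ^ r')) :
    x ∈ LinearMap.range ((γ.toLinearMap - 1 : Module.End k A) ^ (p ^ (r' + 1) - 1)) := by
  set t : Module.End k A := γ.toLinearMap - 1 with ht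
  set r := p ^ r' with hr
  have hpos : 0 < r := Nat.pow_pos (by omega)
  have hq : p ^ (r' + 1) = (p - 3) * r + 3 * r := by
    rw [← add_mul, Nat.sub_add_cancel hp, pow_succ']
  have hC : IsNormRing (γ ^ r) p L e := by
    rw [pow_succ'] at h
    exact h.pow
  have hst : ((γ ^ r).toLinearMap - 1 : Module.End k A) = t ^ r := by
    rw [ht, sub_one_pow_char_pow, ← toLinearMap_pow]
  have key : ∀ z, (t ^ r) z = 0 → z ∈ LinearMap.range (t ^ r) →
      ∃ y, z = (t ^ ((p - 3) * r + 2 * r)) y := by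
    intro z hz hzr
    have := mem_range_sub_one_pow (p := p) hC.map_conj hC.commutator hC.map_elt hC.casimir (x := z)
      (by
        rw [← sub_eq_zero]
        change ((γ ^ r).toLinearMap - 1 : Module.End k A) _ = 0
        rw [hst, hz]) (by rwa [hst])
    rw [hst, ← pow_mul, mul_comm, show p - 1 = p - 3 + 2 by omega, add_mul] at this
    obtain ⟨y, hy⟩ := this
    exact ⟨y, hy.symm⟩
  have htx : t x = 0 := by simp [ht, hx]
  obtain ⟨y, hy⟩ := key x (by rw [← Nat.sub_add_cancel hpos, pow_succ, Module.End.mul_apply, htx,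
    map_zero]) hxs
  obtain ⟨y', hy'⟩ := key ((t ^ ((p - 3) * r + r + 1)) y)
    (by
      rw [← Module.End.mul_apply, ← pow_add,
        show r + ((p - 3) * r + r + 1) = 1 + ((p - 3) * r + 2 * r) by ring, pow_add,
        Module.End.mul_apply, ← hy, pow_one, htx])
    (by
      rw [show (p - 3) * r + r + 1 = r + ((p - 3) * r + 1) by ring, pow_add]
      exact ⟨_, rfl⟩)
  refine ⟨y', ?_⟩
  rw [hq, show (p - 3) * r + 3 * r - 1 = (r - 1) + ((p - 3) * r + 2 * r) by omega, pow_add,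
    Module.End.mul_apply, ← hy', ← Module.End.mul_apply, ← pow_add,
    show r - 1 + ((p - 3) * r + r + 1) = (p - 3) * r + 2 * r by omega, ← hy]

/-- A `γ`-fixed element of the image of `γ ^ p ^ r' - 1` is a norm. -/
theorem IsNormRing.mem_range_norm {p : ℕ} [hp : Fact p.Prime] [CharP k p] {r' : ℕ}
    (h : IsNormRing γ (p ^ (r' + 1)) L e) (hγ : γ ^ p ^ (r' + 1) = 1) {x : A} (hx : γ x = x)
    (hxs : x ∈ LinearMap.range ((γ.toLinearMap - 1 : Module.End k A) ^ p ^ r')) :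
    x ∈ LinearMap.range ((γ.toLinearMap - 1 : Module.End k A) ^ (p ^ (r' + 1) - 1)) := by
  rcases hp.out.two_le.eq_or_lt with rfl | hp3
  · exact mem_range_sub_one_pow_two h hγ hx hxs
  · exact mem_range_sub_one_pow_of_odd hp3 h hx hxs

end General

section StablyTrivial

variable {k G : Type} [Field k] [Group G]
variable {V W : Type} [AddCommGroup V] [Module k V] [AddCommGroup W] [Module k W]
  {ρV : Representation k G V} {ρW : Representation k G W}

theorem Equivariant.apply {f : V →ₗ[k] W} (hf : Equivariant ρV ρW f) (g : G) (v : V) :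
    f (ρV g v) = ρW g (f v) := LinearMap.congr_fun (hf g) v

variable (k G V) in
/-- The representation of `G` on functions `G → V` by left translation. -/
def translationRep : Representation k G (G → V) where
  toFun g := LinearMap.funLeft k V fun x => g⁻¹ * x
  map_one' := by
    ext f x
    simp [LinearMap.funLeft]
  map_mul' g h := by
    ext f x
    simp [LinearMap.funLeft, mul_assoc]

theorem translationRep_apply (g : G) (f : G → V) (x : G) :
    translationRep k G V g f x = f (g⁻¹ * x) := rfl

theorem rho_mul_apply (ρV : Representation k G V) (g g' : G) (v : V) :
    ρV (g * g') v = ρV g (ρV g' v) := by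
  rw [map_mul, Module.End.mul_apply]

/-- An equivariant map as a map of modules over the group algebra. -/
noncomputable def Equivariant.toModuleHom {f : V →ₗ[k] W} (hf : Equivariant ρV ρW f) :
    ρV.asModule →ₗ[MonoidAlgebra k G] ρW.asModule :=
  MonoidAlgebra.equivariantOfLinearOfComm
    (ρW.asModuleEquiv.symm.toLinearMap ∘ₗ f ∘ₗ ρV.asModuleEquiv.toLinearMap) fun g v => by
      simp only [Representation.single_smul, one_smul]
      exact hf.apply g _

theorem exists_equivariant_section (hP : Module.Projective (MonoidAlgebra k G) ρW.asModule)
    {f : V →ₗ[k] W} (hf : Equivariant ρV ρW f) (hs : Function.Surjective f) :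
    ∃ s : W →ₗ[k] V, Equivariant ρW ρV s ∧ f ∘ₗ s = LinearMap.id := by
  obtain ⟨s, hs⟩ := Module.projective_lifting_property hf.toModuleHom LinearMap.id hs
  refine ⟨ρV.asModuleEquiv.toLinearMap ∘ₗ s.restrictScalars k ∘ₗ
    ρW.asModuleEquiv.symm.toLinearMap, fun g => ?_, ?_⟩
  · ext1 w
    change ρV.asModuleEquiv (s (ρW.asModuleEquiv.symm (ρW g w))) = _
    rw [Representation.asModuleEquiv_symm_map_rho, map_smul]
    simp only [MonoidAlgebra.of_apply, Representation.single_smul, one_smul]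
    rfl
  · ext1 w
    exact LinearMap.congr_fun hs (ρW.asModuleEquiv.symm w)

/-- The action of a group element as a linear equivalence. -/
def repEquiv {V : Type} [AddCommGroup V] [Module k V] (ρ : Representation k G V) (g : G) :
    V ≃ₗ[k] V :=
  LinearEquiv.ofLinearMap (ρ g) (ρ g⁻¹) (by ext; simp) (by ext; simp)

theorem repEquiv_apply (g : G) (v : V) : repEquiv ρV g v = ρV g v := rfl

theorem repEquiv_symm_apply (g : G) (v : V) : (repEquiv ρV g).symm v = ρV g⁻¹ v := rfl

theorem arrowCongr_repEquiv_pow (g : G) (j : ℕ) (h : V →ₗ[k] W) :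
    ((((repEquiv ρV g).arrowCongr (repEquiv ρW g)).toLinearMap :
      Module.End k (V →ₗ[k] W)) ^ j) h = ρW (g ^ j) ∘ₗ h ∘ₗ ρV (g ^ j)⁻¹ := by
  induction j with
  | zero => ext; simp
  | succ j ih =>
    ext v
    rw [pow_succ', Module.End.mul_apply, ih]
    simp only [LinearEquiv.coe_coe, LinearEquiv.arrowCongr_apply, repEquiv_symm_apply,
      repEquiv_apply, LinearMap.comp_apply]
    rw [pow_succ', mul_inv_rev, rho_mul_apply, rho_mul_apply]

variable [Fintype G]

/-- The equivariant map `(G → V) → W` determined by a linear map `V → W`. -/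
noncomputable def translationLift (ρW : Representation k G W) (h : V →ₗ[k] W) :
    (G → V) →ₗ[k] W :=
  ∑ g, ρW g ∘ₗ h ∘ₗ LinearMap.proj g

theorem translationLift_apply (h : V →ₗ[k] W) (f : G → V) :
    translationLift ρW h f = ∑ g, ρW g (h (f g)) := by
  simp [translationLift, LinearMap.sum_apply]

theorem equivariant_translationLift (h : V →ₗ[k] W) :
    Equivariant (translationRep k G V) ρW (translationLift ρW h) := by
  intro g
  ext1 f
  simp only [LinearMap.comp_apply, translationLift_apply, translationRep_apply, map_sum]
  refine (Fintype.sum_equiv (Equiv.mulLeft g) _ _ fun x => ?_).symm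
  rw [Equiv.coe_mulLeft, inv_mul_cancel_left, rho_mul_apply]

theorem projective_translationRep :
    Module.Projective (MonoidAlgebra k G) (translationRep k G V).asModule := by
  classical
  refine Module.Projective.of_lifting_property'' fun f hf => ?_
  set M := (translationRep k G V).asModule →₀ MonoidAlgebra k G
  let f' : M →ₗ[k] (G → V) := (translationRep k G V).asModuleEquiv.toLinearMap ∘ₗ
    f.restrictScalars k
  have hf' : Function.Surjective f' := hf
  obtain ⟨s, hs⟩ := f'.exists_rightInverse_of_surjective (LinearMap.range_eq_top.2 hf')
  let ρM : Representation k G M := Representation.ofModule' M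
  have hρM : ∀ g m, ρM g m = MonoidAlgebra.single g (1 : k) • m := fun g m => by
    simp [ρM, Representation.ofModule']
  let σ := translationLift ρM (s ∘ₗ LinearMap.single k (fun _ : G => V) 1)
  have hσ : Equivariant (translationRep k G V) ρM σ := equivariant_translationLift _
  have hfe : ∀ g m, f' (ρM g m) = translationRep k G V g (f' m) := fun g m => by
    rw [hρM]
    simp only [f', LinearMap.comp_apply, LinearMap.restrictScalars_apply, map_smul,
      LinearEquiv.coe_coe, Representation.single_smul, one_smul]
    rfl
  refine ⟨MonoidAlgebra.equivariantOfLinearOfComm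
    (σ ∘ₗ (translationRep k G V).asModuleEquiv.toLinearMap) fun g v => ?_, ?_⟩
  · rw [← hρM]
    simp only [Representation.single_smul, one_smul]
    exact hσ.apply g _
  · suffices ∀ v, f' (σ v) = v from LinearMap.ext this
    intro v
    rw [translationLift_apply, map_sum]
    have h1 : ∀ g, f' (ρM g ((s ∘ₗ LinearMap.single k (fun _ : G => V) 1) (v g)))
        = Pi.single g (v g) := fun g => by
      rw [hfe]
      change translationRep k G V g (f' (s (Pi.single 1 (v g)))) = _
      rw [show f' (s (Pi.single 1 (v g))) = Pi.single 1 (v g) from LinearMap.congr_fun hs _]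
      ext x
      simp [translationRep_apply, Pi.single_apply, inv_mul_eq_one, eq_comm]
    rw [sum_congr rfl fun g _ => h1 g]
    exact Finset.univ_sum_single v

theorem StablyTrivial.exists_sum {f : V →ₗ[k] W} (hf : StablyTrivial ρV ρW f) :
    ∃ h : V →ₗ[k] W, f = ∑ g, ρW g ∘ₗ h ∘ₗ ρV g⁻¹ := by
  classical
  obtain ⟨P, _, _, ρP, hP, a, b, ha, hb, rfl⟩ := hf
  obtain ⟨s, hs, hbs⟩ := exists_equivariant_section hP
    (equivariant_translationLift (ρW := ρP) LinearMap.id) fun x => ⟨Pi.single 1 x, by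
      rw [translationLift_apply, Finset.sum_eq_single 1] <;> simp +contextual⟩
  refine ⟨b ∘ₗ LinearMap.proj 1 ∘ₗ s ∘ₗ a, ?_⟩
  ext v
  have := LinearMap.congr_fun hbs (a v)
  rw [LinearMap.comp_apply, translationLift_apply, LinearMap.id_apply] at this
  rw [LinearMap.comp_apply, ← this, LinearMap.sum_apply, map_sum]
  refine sum_congr rfl fun g _ => ?_
  simp only [LinearMap.comp_apply, LinearMap.proj_apply, ha.apply, hs.apply, hb.apply,
    translationRep_apply, inv_inv, mul_one, LinearMap.id_apply]

theorem stablyTrivial_sum (h : V →ₗ[k] W) :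
    StablyTrivial ρV ρW (∑ g, ρW g ∘ₗ h ∘ₗ ρV g⁻¹) := by
  refine ⟨G → V, inferInstance, inferInstance, translationRep k G V, projective_translationRep,
    LinearMap.pi fun g => ρV g⁻¹, translationLift ρW h, fun g => ?_,
    equivariant_translationLift h, ?_⟩
  · ext v x
    simp only [LinearMap.comp_apply, LinearMap.pi_apply, translationRep_apply, mul_inv_rev,
      inv_inv, rho_mul_apply]
  · ext v
    simp [translationLift_apply, LinearMap.sum_apply]

theorem sum_eq_sum_range_pow {M : Type*} [AddCommMonoid M] {g : G}
    (hg : ∀ x, x ∈ Subgroup.zpowers g) (F : G → M) :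
    ∑ x, F x = ∑ j ∈ range (Fintype.card G), F (g ^ j) := by
  classical
  rw [← Nat.card_eq_fintype_card, ← IsCyclic.image_range_card hg, sum_image]
  rw [← orderOf_eq_card_of_forall_mem_zpowers hg, coe_range]
  exact pow_injOn_Iio_orderOf

theorem stablyTrivial_iff_isNorm {g : G} (hg : ∀ x, x ∈ Subgroup.zpowers g) {f : V →ₗ[k] W} :
    StablyTrivial ρV ρW f ↔
      IsNorm ((repEquiv ρV g).arrowCongr (repEquiv ρW g)).toLinearMap (Fintype.card G) f := by
  have key : ∀ h : V →ₗ[k] W, ∑ x, ρW x ∘ₗ h ∘ₗ ρV x⁻¹ = ∑ j ∈ range (Fintype.card G),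
      ((((repEquiv ρV g).arrowCongr (repEquiv ρW g)).toLinearMap :
        Module.End k (V →ₗ[k] W)) ^ j) h := fun h => by
    simp only [arrowCongr_repEquiv_pow]
    exact sum_eq_sum_range_pow hg _
  constructor
  · intro hf
    obtain ⟨h, rfl⟩ := hf.exists_sum
    exact ⟨h, key h⟩
  · rintro ⟨h, rfl⟩
    rw [← key]
    exact stablyTrivial_sum h

end StablyTrivial

section NormMaps

variable {k : Type*} [Field k] {U V W X : Type*} [AddCommGroup U] [Module k U]
  [AddCommGroup V] [Module k V] [AddCommGroup W] [Module k W] [AddCommGroup X] [Module k X]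
  {β : U ≃ₗ[k] U} {γ : V ≃ₗ[k] V} {δ : W ≃ₗ[k] W} {ε : X ≃ₗ[k] X} {q : ℕ}

theorem LinearEquiv.apply_symm_comm {g : V →ₗ[k] W} (hg : ∀ v, g (γ v) = δ (g v)) (v : V) :
    g (γ.symm v) = δ.symm (g v) := by
  rw [LinearEquiv.eq_symm_apply, ← hg, LinearEquiv.apply_symm_apply]

theorem IsNorm.comp_left {f : V →ₗ[k] W} (hf : IsNorm (γ.arrowCongr δ).toLinearMap q f)
    (g : W →ₗ[k] X) (hg : ∀ w, g (δ w) = ε (g w)) :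
    IsNorm (γ.arrowCongr ε).toLinearMap q (g ∘ₗ f) :=
  hf.map (LinearMap.compRight k g) fun h => by
    ext v
    simp [LinearEquiv.arrowCongr_apply, hg]

theorem IsNorm.comp_right {f : V →ₗ[k] W} (hf : IsNorm (γ.arrowCongr δ).toLinearMap q f)
    (g : U →ₗ[k] V) (hg : ∀ u, g (β u) = γ (g u)) :
    IsNorm (β.arrowCongr δ).toLinearMap q (f ∘ₗ g) :=
  hf.map (LinearMap.lcomp k W g) fun h => by
    ext v
    simp [LinearEquiv.arrowCongr_apply, LinearEquiv.apply_symm_comm hg]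

theorem IsNorm.curry {f : U ⊗[k] V →ₗ[k] W}
    (hf : IsNorm ((TensorProduct.congr β γ).arrowCongr δ).toLinearMap q f) :
    IsNorm (β.arrowCongr (γ.arrowCongr δ)).toLinearMap q (TensorProduct.curry f) :=
  hf.map (TensorProduct.lcurry (RingHom.id k) U V W) fun h => by
    ext u v
    simp [LinearEquiv.arrowCongr_apply]

theorem IsNorm.flip {f : U →ₗ[k] V →ₗ[k] W}
    (hf : IsNorm (β.arrowCongr (γ.arrowCongr δ)).toLinearMap q f) :
    IsNorm (γ.arrowCongr (β.arrowCongr δ)).toLinearMap q f.flip :=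
  hf.map (LinearMap.lflip (R₀ := k)).toLinearMap fun h => by
    ext u v
    simp [LinearEquiv.arrowCongr_apply]

theorem IsNorm.compr₂ {f : U →ₗ[k] V →ₗ[k] W}
    (hf : IsNorm (β.arrowCongr (γ.arrowCongr δ)).toLinearMap q f)
    {g : W →ₗ[k] X} (hg : ∀ w, g (δ w) = ε (g w)) :
    IsNorm (β.arrowCongr (γ.arrowCongr ε)).toLinearMap q (f.compr₂ g) :=
  hf.comp_left (LinearMap.compRight k g) fun h => by
    ext v
    simp [LinearEquiv.arrowCongr_apply, hg]

end NormMaps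

section PartialTrace

variable {k : Type*} [Field k] {A : Type*} [AddCommGroup A] [Module k A] [FiniteDimensional k A]

variable (k A) in
/-- The trace over the second factor of a map `A → A ⊗ A`. -/
noncomputable def partialTrace : (A →ₗ[k] A ⊗[k] A) →ₗ[k] A :=
  (TensorProduct.rid k A).toLinearMap ∘ₗ (LinearMap.trace k A).lTensor A ∘ₗ
    (lTensorHomEquivHomLTensor k A A A).symm.toLinearMap

theorem partialTrace_tmul_right (x : A) (f : Module.End k A) :
    partialTrace k A (TensorProduct.mk k A A x ∘ₗ f) = LinearMap.trace k A f • x := by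
  have : TensorProduct.mk k A A x ∘ₗ f = lTensorHomEquivHomLTensor k A A A (x ⊗ₜ f) := by
    ext a
    simp
  rw [this, partialTrace, LinearMap.comp_apply, LinearMap.comp_apply, LinearEquiv.coe_coe,
    LinearEquiv.coe_coe, LinearEquiv.symm_apply_apply, LinearMap.lTensor_tmul,
    TensorProduct.rid_tmul]

theorem partialTrace_tmul_left (f : Module.End k A) (y : A) :
    partialTrace k A ((TensorProduct.mk k A A).flip y ∘ₗ f) = f y := by
  let b := Module.finBasis k A
  have : (TensorProduct.mk k A A).flip y ∘ₗ f
      = ∑ i, TensorProduct.mk k A A (f (b i)) ∘ₗ (b.coord i).smulRight y := by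
    ext a
    have : f a = ∑ i, b.repr a i • f (b i) := by
      conv_lhs => rw [← b.sum_repr a, map_sum]
      simp only [map_smul]
    simp [LinearMap.sum_apply, this, TensorProduct.smul_tmul']
  rw [this, map_sum]
  conv_rhs => rw [← b.sum_repr y, map_sum]
  simp only [partialTrace_tmul_right, LinearMap.trace_smulRight, map_smul, Module.Basis.coord_apply]

theorem partialTrace_rTensor (g : A →ₗ[k] Module.End k A) (z : A ⊗[k] A) :
    partialTrace k A (LinearMap.applyₗ z ∘ₗ LinearMap.rTensorHom A ∘ₗ g)
      = TensorProduct.lift g.flip z := by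
  induction z with
  | zero => simp
  | add z z' h h' => rw [map_add, map_add, LinearMap.add_comp, map_add, h, h']
  | tmul x y =>
    rw [TensorProduct.lift.tmul, ← partialTrace_tmul_left]
    congr 1

theorem partialTrace_lTensor (g : A →ₗ[k] Module.End k A) (z : A ⊗[k] A) :
    partialTrace k A (LinearMap.applyₗ z ∘ₗ LinearMap.lTensorHom A ∘ₗ g)
      = contractSnd k A z (LinearMap.trace k A ∘ₗ g.flip) := by
  rw [contractSnd_apply]
  induction z with
  | zero => simp
  | add z z' h h' => rw [map_add, map_add, LinearMap.add_comp, map_add, h, h', map_add]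
  | tmul x y =>
    rw [LinearMap.lTensor_tmul, TensorProduct.rid_tmul, LinearMap.comp_apply,
      ← partialTrace_tmul_right]
    congr 1

theorem partialTrace_arrowCongr (γ : A ≃ₗ[k] A) (F : A →ₗ[k] A ⊗[k] A) :
    partialTrace k A (γ.arrowCongr (TensorProduct.congr γ γ) F) = γ (partialTrace k A F) := by
  obtain ⟨z, rfl⟩ := (lTensorHomEquivHomLTensor k A A A).surjective F
  induction z with
  | zero => simp
  | add z z' h h' => simp only [map_add, h, h']
  | tmul x f =>
    have h1 : lTensorHomEquivHomLTensor k A A A (x ⊗ₜ f) = TensorProduct.mk k A A x ∘ₗ f := by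
      ext a
      simp
    have h2 : γ.arrowCongr (TensorProduct.congr γ γ) (TensorProduct.mk k A A x ∘ₗ f)
        = TensorProduct.mk k A A (γ x) ∘ₗ γ.conj f := by
      ext a
      simp [LinearEquiv.arrowCongr_apply, LinearEquiv.conj_apply_apply]
    rw [h1, h2, partialTrace_tmul_right, partialTrace_tmul_right, LinearMap.trace_conj', map_smul]

end PartialTrace

section OfStableTTRing

variable {k : Type*} [Field k] {A : Type*} [AddCommGroup A] [Module k A]
  {γ : A ≃ₗ[k] A} {q : ℕ} {L : A →ₗ[k] Module.End k A}

theorem commutator_of_associator (hL : ∀ a, L (γ a) = γ.conj (L a))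
    (h : IsNorm (γ.arrowCongr (γ.arrowCongr γ.conj)).toLinearMap q (associatorMap L))
    (hs : IsNorm (γ.arrowCongr γ.conj).toLinearMap q (L.flip - L : A →ₗ[k] Module.End k A)) :
    IsNorm (γ.arrowCongr (γ.arrowCongr γ.conj)).toLinearMap q (commutatorMap L) := by
  have : commutatorMap L = (associatorMap L).flip - associatorMap L
      - (L.flip - L : A →ₗ[k] Module.End k A).compr₂ L := by
    ext a b c
    simp [commutatorMap_apply, associatorMap_apply]
    abel
  rw [this]
  exact (h.flip.sub h).sub (hs.compr₂ hL)

variable [FiniteDimensional k A]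

theorem isNorm_one_sub_casimirMap {e : A ⊗[k] A} {o : A} {σ : A →ₗ[k] A ⊗[k] A}
    (hL : ∀ a, L (γ a) = γ.conj (L a))
    (he : TensorProduct.map γ.toLinearMap γ.toLinearMap e = e)
    (has : IsNorm (γ.arrowCongr (γ.arrowCongr γ.conj)).toLinearMap q (associatorMap L))
    (hsw : IsNorm (γ.arrowCongr γ.conj).toLinearMap q (L.flip - L : A →ₗ[k] Module.End k A))
    (ho : IsNorm γ.conj.toLinearMap q (L.flip o - 1 : Module.End k A))
    (hm : IsNorm γ.toLinearMap q (TensorProduct.lift L e - o))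
    {R S : A →ₗ[k] A ⊗[k] A} (hR : ∀ a, R a = (L.flip a).lTensor A e)
    (hS : ∀ a, S a = (L a).rTensor A e)
    (hRσ : IsNorm (γ.arrowCongr (TensorProduct.congr γ γ)).toLinearMap q (R - σ))
    (hSσ : IsNorm (γ.arrowCongr (TensorProduct.congr γ γ)).toLinearMap q (S - σ)) :
    IsNorm γ.conj.toLinearMap q (1 - casimirMap L e) := by
  have hes : TensorProduct.map γ.symm.toLinearMap γ.symm.toLinearMap e = e := by
    conv_lhs => rw [← he]
    rw [← LinearMap.comp_apply, ← TensorProduct.map_comp]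
    convert LinearMap.id_apply (R := k) e
    convert TensorProduct.map_id
    · exact symm_mul_self γ
    · exact symm_mul_self γ
  have hlift : ∀ f : A →ₗ[k] Module.End k A, TensorProduct.lift (γ.arrowCongr γ.conj f) e
      = γ (TensorProduct.lift f e) := fun f => by
    conv_rhs => rw [← hes]
    generalize e = z
    induction z with
    | zero => simp
    | add z z' h h' => simp only [map_add, h, h']
    | tmul x y => simp [LinearEquiv.arrowCongr_apply, LinearEquiv.conj_apply_apply]
  let Φ₁ : (A →ₗ[k] A ⊗[k] A) →ₗ[k] Module.End k A :=
    { toFun := fun F => partialTrace k A ∘ₗ LinearMap.compRight k F ∘ₗ L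
      map_add' := fun F F' => by
        ext a
        simp only [LinearMap.comp_apply, LinearMap.add_apply]
        rw [← map_add]
        congr 1
      map_smul' := fun c F => by
        ext a
        simp only [LinearMap.comp_apply, LinearMap.smul_apply, RingHom.id_apply]
        rw [← map_smul]
        congr 1 }
  let Λ : (A →ₗ[k] Module.End k A) →ₗ[k] A :=
    LinearMap.applyₗ e ∘ₗ (TensorProduct.lift.equiv (RingHom.id k) A A A).toLinearMap
  have hΛ : ∀ f, Λ f = TensorProduct.lift f e := fun _ => rfl
  let Φ₂ : (A →ₗ[k] A →ₗ[k] Module.End k A) →ₗ[k] Module.End k A :=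
    LinearMap.compRight k (Λ ∘ₗ (LinearMap.lflip (R₀ := k)).toLinearMap)
  have n1 := (hSσ.sub hRσ).map (T' := γ.conj.toLinearMap) Φ₁ fun F => by
    ext a
    change partialTrace k A (_ ∘ₗ L a) = γ (partialTrace k A (F ∘ₗ L (γ.symm a)))
    rw [← partialTrace_arrowCongr]
    congr 1
    ext b
    have : γ.symm (L a b) = L (γ.symm a) (γ.symm b) := by
      have := hL (γ.symm a)
      rw [LinearEquiv.apply_symm_apply] at this
      rw [this, LinearEquiv.conj_apply_apply, LinearEquiv.symm_apply_apply]
    simp [LinearEquiv.arrowCongr_apply, this]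
  have n2 := has.map (T' := γ.conj.toLinearMap) Φ₂ fun F => by
    ext a
    change TensorProduct.lift _ e = γ (TensorProduct.lift (F (γ.symm a)).flip e)
    rw [← hlift]
    congr 1
  have hLf : ∀ x, L.flip (γ x) = γ.conj (L.flip x) := fun x => by
    ext a
    have := hL (γ.symm a)
    rw [LinearEquiv.apply_symm_apply] at this
    simp [this, LinearEquiv.conj_apply_apply]
  have n3 := (hsw.map (T' := γ.toLinearMap) Λ fun f => hlift f).map
    (T' := γ.conj.toLinearMap) L.flip hLf
  have n4 := hm.map (T' := γ.conj.toLinearMap) L.flip hLf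
  have h1 : ∀ a, Φ₁ S a = TensorProduct.lift (L ∘ₗ L a).flip e := fun a => by
    rw [← partialTrace_rTensor]
    change partialTrace k A (S ∘ₗ L a) = _
    congr 1
    ext1 b
    exact hS _
  have h2 : Φ₁ R = casimirMap L e := by
    ext a
    have : casimirMap L e a
        = contractSnd k A e (LinearMap.trace k A ∘ₗ (L.flip ∘ₗ L a).flip) := rfl
    rw [this, ← partialTrace_lTensor]
    change partialTrace k A (R ∘ₗ L a) = _
    congr 1
    ext1 b
    exact hR _
  have h3 : (1 - casimirMap L e : Module.End k A) = Φ₁ (S - σ - (R - σ)) - Φ₂ (associatorMap L)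
      - L.flip (Λ (L.flip - L)) - L.flip (TensorProduct.lift L e - o) - (L.flip o - 1) := by
    rw [sub_sub_sub_cancel_right, map_sub, h2, map_sub Λ, hΛ, hΛ, map_sub, map_sub]
    have h4 : Φ₁ S = Φ₂ (associatorMap L) + L.flip (TensorProduct.lift L.flip e) := by
      ext a
      rw [h1]
      change _ = TensorProduct.lift (associatorMap L a).flip e + L a (TensorProduct.lift L.flip e)
      generalize e = z
      induction z with
      | zero => simp
      | add z z' h h' => simp only [map_add, h, h']; abel
      | tmul x y => simp [associatorMap_apply]
    rw [h4]
    abel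
  rw [h3]
  exact (((n1.sub n2).sub n3).sub n4).sub ho

end OfStableTTRing

section OfStableTTRing

variable {k G : Type} [Field k] [Group G]

theorem repEquiv_tprod {V W : Type} [AddCommGroup V] [Module k V] [AddCommGroup W] [Module k W]
    (ρV : Representation k G V) (ρW : Representation k G W) (g : G) :
    repEquiv (ρV.tprod ρW) g = TensorProduct.congr (repEquiv ρV g) (repEquiv ρW g) := by
  ext z
  induction z with
  | zero => simp
  | add z z' h h' => simp only [map_add, h, h']
  | tmul x y => simp [repEquiv_apply, Representation.tprod_apply]

variable [Fintype G] {A : Type} [AddCommGroup A] [Module k A] [FiniteDimensional k A]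
  {ρ : Representation k G A}

theorem StableTTRing.isNormRing (T : StableTTRing ρ) {g : G}
    (hg : ∀ x, x ∈ Subgroup.zpowers g) :
    IsNormRing (repEquiv ρ g) (Fintype.card G) (TensorProduct.curry T.mul) (T.sec (T.one 1)) := by
  set γ := repEquiv ρ g with hγ
  set o := T.one 1 with ho
  set L : A →ₗ[k] Module.End k A := TensorProduct.curry T.mul with hL
  have hLa : ∀ a b, L a b = T.mul (a ⊗ₜ b) := fun _ _ => rfl
  have hmul : ∀ z, T.mul (TensorProduct.congr γ γ z) = γ (T.mul z) := fun z => by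
    rw [hγ, ← repEquiv_tprod, repEquiv_apply, repEquiv_apply, T.mul_equivariant.apply]
  have hsec : ∀ a, T.sec (γ a) = TensorProduct.congr γ γ (T.sec a) := fun a => by
    rw [hγ, ← repEquiv_tprod, repEquiv_apply, repEquiv_apply, T.sec_equivariant.apply]
  have hγo : γ o = o := by
    rw [hγ, repEquiv_apply, ho, ← T.one_equivariant.apply, Representation.trivial_apply]
  have hconj : ∀ a, L (γ a) = γ.conj (L a) := fun a => by
    ext b
    rw [LinearEquiv.conj_apply_apply, hLa, hLa, ← hmul, TensorProduct.congr_tmul,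
      LinearEquiv.apply_symm_apply]
  have hassoc : IsNorm (γ.arrowCongr (γ.arrowCongr γ.conj)).toLinearMap (Fintype.card G)
      (associatorMap L) := by
    have h := (stablyTrivial_iff_isNorm hg).1 T.assoc
    rw [repEquiv_tprod, repEquiv_tprod, ← hγ] at h
    have key : associatorMap L = TensorProduct.curry (TensorProduct.curry
        (T.mul ∘ₗ T.mul.rTensor A -
          T.mul ∘ₗ T.mul.lTensor A ∘ₗ (TensorProduct.assoc k A A A).toLinearMap)) := by
      ext a b c
      rfl
    rw [key]
    exact h.curry.curry
  have hswap : IsNorm (γ.arrowCongr γ.conj).toLinearMap (Fintype.card G)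
      (L.flip - L : A →ₗ[k] Module.End k A) := by
    have h := (stablyTrivial_iff_isNorm hg).1 T.mul_comm
    rw [repEquiv_tprod, ← hγ] at h
    have key : (L.flip - L : A →ₗ[k] Module.End k A) = TensorProduct.curry
        (T.mul ∘ₗ (TensorProduct.comm k A A).toLinearMap - T.mul) := by
      ext a b
      rfl
    rw [key]
    exact h.curry
  have hone : IsNorm γ.conj.toLinearMap (Fintype.card G) (L o - 1 : Module.End k A) := by
    have h := (stablyTrivial_iff_isNorm hg).1 T.one_mul
    have key : L o - 1 = T.mul ∘ₗ T.one.rTensor A ∘ₗ (TensorProduct.lid k A).symm.toLinearMap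
        - LinearMap.id := by
      ext a
      rfl
    rw [key]
    exact h
  have hone' : IsNorm γ.conj.toLinearMap (Fintype.card G) (L.flip o - 1 : Module.End k A) := by
    have h := (stablyTrivial_iff_isNorm hg).1 T.mul_one
    have key : L.flip o - 1 = T.mul ∘ₗ T.one.lTensor A ∘ₗ (TensorProduct.rid k A).symm.toLinearMap
        - LinearMap.id := by
      ext a
      rfl
    rw [key]
    exact h
  have hse : IsNorm γ.toLinearMap (Fintype.card G) (TensorProduct.lift L (T.sec o) - o) := by
    have h := ((stablyTrivial_iff_isNorm hg).1 T.sep).apply_fixed hγo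
    have key : TensorProduct.lift L = T.mul := by
      ext a b
      rfl
    rw [key]
    exact h
  have he : TensorProduct.map γ.toLinearMap γ.toLinearMap (T.sec o) = T.sec o := by
    conv_rhs => rw [← hγo, hsec]
    rfl
  let R : A →ₗ[k] A ⊗[k] A := LinearMap.applyₗ (T.sec o) ∘ₗ LinearMap.lTensorHom A ∘ₗ L.flip
  let S : A →ₗ[k] A ⊗[k] A := LinearMap.applyₗ (T.sec o) ∘ₗ LinearMap.rTensorHom A ∘ₗ L
  have hR : IsNorm (γ.arrowCongr (TensorProduct.congr γ γ)).toLinearMap (Fintype.card G)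
      (R - T.sec) := by
    have h := (stablyTrivial_iff_isNorm hg).1 T.sec_right
    rw [repEquiv_tprod, ← hγ] at h
    have h' := (h.comp_right (TensorProduct.mk k A A o) (β := γ) fun b => by simp [hγo]).add
      (IsNorm.comp_left hone T.sec hsec)
    convert h' using 1
    ext1 b
    have : (TensorProduct.assoc k A A A) (T.sec o ⊗ₜ b)
        = ((TensorProduct.mk k A A).flip b).lTensor A (T.sec o) := by
      generalize T.sec o = z
      induction z with
      | zero => simp
      | add z z' h h' => rw [TensorProduct.add_tmul, map_add, map_add, h, h']
      | tmul x y => simp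
    simp only [R, LinearMap.sub_apply, LinearMap.add_apply, LinearMap.comp_apply,
      TensorProduct.mk_apply, LinearMap.rTensor_tmul, LinearEquiv.coe_coe, this,
      ← LinearMap.lTensor_comp_apply, map_sub, Module.End.one_apply, hLa]
    rw [sub_add_sub_cancel]
    rfl
  have hS : IsNorm (γ.arrowCongr (TensorProduct.congr γ γ)).toLinearMap (Fintype.card G)
      (S - T.sec) := by
    have h := (stablyTrivial_iff_isNorm hg).1 T.sec_left
    rw [repEquiv_tprod, ← hγ] at h
    have h' := (h.comp_right ((TensorProduct.mk k A A).flip o) (β := γ)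
      fun b => by simp [hγo]).add (IsNorm.comp_left hone' T.sec hsec)
    convert h' using 1
    ext1 b
    have : (TensorProduct.assoc k A A A).symm (b ⊗ₜ T.sec o)
        = (TensorProduct.mk k A A b).rTensor A (T.sec o) := by
      generalize T.sec o = z
      induction z with
      | zero => simp
      | add z z' h h' => rw [TensorProduct.tmul_add, map_add, map_add, h, h']
      | tmul x y => simp
    simp only [S, LinearMap.sub_apply, LinearMap.add_apply, LinearMap.comp_apply,
      TensorProduct.mk_apply, LinearMap.lTensor_tmul, LinearEquiv.coe_coe, this,
      ← LinearMap.rTensor_comp_apply, map_sub, Module.End.one_apply, LinearMap.flip_apply, hLa]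
    rw [sub_add_sub_cancel]
    rfl
  exact
    { map_conj := hconj
      map_elt := he
      commutator := commutator_of_associator hconj hassoc hswap
      associator := hassoc
      swap := hswap
      casimir := isNorm_one_sub_casimirMap hconj he hassoc hswap hone' hse
        (fun _ => rfl) (fun _ => rfl) hR hS }

end OfStableTTRing

section ProjectivePart

variable {k : Type*} [Field k] {V : Type*} [AddCommGroup V] [Module k V] [FiniteDimensional k V]

/-- A version of Fitting's lemma. -/
theorem exists_pow_succ_mul_idempotent (f : Module.End k V) :
    ∃ (n : ℕ) (a : Polynomial k),
      f ^ (n + 1) * Polynomial.aeval f a * f ^ (n + 1) = f ^ (n + 1) := by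
  obtain ⟨m, hm, hXm⟩ := Polynomial.exists_eq_pow_rootMultiplicity_mul_and_not_dvd (minpoly k f)
    (minpoly.ne_zero (Algebra.IsIntegral.isIntegral f)) 0
  set n := (minpoly k f).rootMultiplicity 0
  rw [map_zero, sub_zero] at hm hXm
  obtain ⟨a, b, hab⟩ : IsCoprime (Polynomial.X ^ (n + 1)) m :=
    ((Polynomial.irreducible_X.coprime_iff_not_dvd).2 hXm).pow_left
  refine ⟨n, a, ?_⟩
  have h1 : (Polynomial.X ^ (n + 1) * a * Polynomial.X ^ (n + 1) : Polynomial k)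
      = Polynomial.X ^ (n + 1) - minpoly k f * (b * Polynomial.X) := by
    conv_rhs => rw [hm]
    linear_combination (Polynomial.X ^ (n + 1)) * hab
  simpa using congrArg (Polynomial.aeval f) h1

theorem exists_norm_idempotent {p : ℕ} [Fact p.Prime] [CharP k p] {r' : ℕ} {γ : V ≃ₗ[k] V}
    (hγ : γ ^ p ^ (r' + 1) = 1)
    (hK : ∀ x, γ x = x → x ∈ LinearMap.range ((γ.toLinearMap - 1 : Module.End k V) ^ p ^ r') →
      x ∈ LinearMap.range ((γ.toLinearMap - 1 : Module.End k V) ^ (p ^ (r' + 1) - 1))) :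
    ∃ P : Module.End k V, P ∈ conjFixed γ ∧ P * P = P ∧
      IsNorm γ.conj.toLinearMap (p ^ (r' + 1)) P ∧ ∀ x, P x = 0 → (γ ^ p ^ r') x = x := by
  set t : Module.End k V := γ.toLinearMap - 1 with ht
  set q := p ^ (r' + 1) with hq
  set N : Module.End k V := t ^ (q - 1) with hN
  have htq : t ^ q = 0 := by
    rw [ht, hq, sub_one_pow_char_pow, ← toLinearMap_pow, hγ]
    exact sub_self _
  have hqpos : 0 < q := Nat.pow_pos (Fact.out : p.Prime).pos
  have hγN : ∀ x, γ (N x) = N x := fun x => by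
    have : t (N x) = 0 := by
      rw [← Module.End.mul_apply, hN, ← pow_succ', Nat.sub_add_cancel hqpos, htq,
        LinearMap.zero_apply]
    rw [ht, LinearMap.sub_apply, sub_eq_zero] at this
    exact this
  obtain ⟨h0, h0N⟩ : ∃ h0 : Module.End k V, ∀ x, N (h0 (N x)) = N x := by
    obtain ⟨s, hs⟩ := N.rangeRestrict.exists_rightInverse_of_surjective N.range_rangeRestrict
    obtain ⟨h0, hh0⟩ := LinearMap.exists_extend s
    refine ⟨h0, fun x => ?_⟩
    have h1 : h0 (N x) = s (N.rangeRestrict x) := LinearMap.congr_fun hh0 (N.rangeRestrict x)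
    have h2 := LinearMap.congr_fun hs (N.rangeRestrict x)
    rw [h1]
    exact congrArg Subtype.val h2
  set f : Module.End k V :=
    ∑ j ∈ range q, ((γ.conj.toLinearMap : Module.End k (Module.End k V)) ^ j) h0 with hf
  have hfN : ∀ x, f (N x) = N x := fun x => by
    rw [hf, sum_conj_pow_apply_of_fixed h0 (hγN x), hq, sum_range_pow_eq_sub_one_pow]
    exact h0N x
  have hfnorm : IsNorm γ.conj.toLinearMap q f := ⟨h0, rfl⟩
  have hfix : f ∈ conjFixed γ := by
    have hone : (γ.conj.toLinearMap : Module.End k (Module.End k V)) ^ q = 1 := by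
      rw [← toLinearMap_pow, ← conj_linearEquiv_pow, hγ]
      ext f x
      rfl
    rw [mem_conjFixed]
    change γ.conj.toLinearMap f = f
    have := sum_range_succ' (fun j => ((γ.conj.toLinearMap : Module.End k (Module.End k V)) ^ j) h0) q
    rw [sum_range_succ, hone, pow_zero, add_left_inj] at this
    conv_rhs => rw [hf, this]
    rw [hf, map_sum]
    exact sum_congr rfl fun j _ => by rw [pow_succ', Module.End.mul_apply]
  obtain ⟨n, a, hyf⟩ := exists_pow_succ_mul_idempotent f
  have hfix' : Polynomial.aeval f a ∈ conjFixed γ := by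
    rw [Polynomial.aeval_eq_sum_range, mem_conjFixed, map_sum]
    refine sum_congr rfl fun i _ => ?_
    rw [map_smul]
    exact congrArg _ (pow_mem hfix i)
  set F := f ^ (n + 1) with hF
  set y := Polynomial.aeval f a with hy
  have hFN : ∀ x, F (N x) = N x := fun x => by
    rw [hF, Module.End.pow_apply]
    exact Function.iterate_fixed (hfN x) _
  have hPfix : F * y ∈ conjFixed γ := Submonoid.mul_mem _ (pow_mem hfix _) hfix'
  refine ⟨F * y, hPfix, ?_, ?_, fun x hx => ?_⟩
  · rw [← mul_assoc, hyf]
  · rw [hF, pow_succ', mul_assoc]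
    exact hfnorm.mul_right (Submonoid.mul_mem _ (pow_mem hfix _) hfix')
  · have hFyt : ∀ z, (F * y) (t z) = t ((F * y) z) := fun z => by
      have := hPfix
      rw [mem_conjFixed] at this
      have h1 : (F * y) (γ z) = γ ((F * y) z) := by
        conv_lhs => rw [← this, LinearEquiv.conj_apply_apply, LinearEquiv.symm_apply_apply]
      rw [ht]
      simp only [LinearMap.sub_apply, map_sub, Module.End.one_apply, LinearEquiv.coe_coe, h1]
    have hFyt' : ∀ j, (F * y) ((t ^ j) x) = 0 := fun j => by
      induction j with
      | zero => exact hx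
      | succ j ih =>
        rw [pow_succ', Module.End.mul_apply t, hFyt, ih, map_zero]
    have hzero : ∀ j, (t ^ (p ^ r' + j)) x = 0 → (t ^ p ^ r') x = 0 := fun j => by
      induction j with
      | zero => exact id
      | succ j ih =>
        intro hj
        refine ih ?_
        rw [← add_assoc, pow_succ', Module.End.mul_apply] at hj
        have hfx : γ ((t ^ (p ^ r' + j)) x) = (t ^ (p ^ r' + j)) x := by
          rw [ht, LinearMap.sub_apply, sub_eq_zero] at hj
          exact hj
        obtain ⟨z, hz⟩ := hK _ hfx ⟨(t ^ j) x, by rw [pow_add, Module.End.mul_apply]⟩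
        rw [← hz]
        change N z = 0
        rw [← hFN, ← hyf, Module.End.mul_apply, hFN]
        change (F * y) ((t ^ (q - 1)) z) = 0
        rw [hz, hFyt']
    have hs := hzero q (by rw [pow_add, htq, mul_zero, LinearMap.zero_apply])
    rw [ht, sub_one_pow_char_pow, ← toLinearMap_pow, LinearMap.sub_apply, sub_eq_zero] at hs
    exact hs

end ProjectivePart

section StablyEqual

variable {k G : Type} [Field k] [Group G]
variable {V W X Y : Type} [AddCommGroup V] [Module k V] [AddCommGroup W] [Module k W]
  [AddCommGroup X] [Module k X] [AddCommGroup Y] [Module k Y]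
  {ρV : Representation k G V} {ρW : Representation k G W} {ρX : Representation k G X}
  {ρY : Representation k G Y}

theorem Equivariant.comp {g : W →ₗ[k] X} {f : V →ₗ[k] W} (hg : Equivariant ρW ρX g)
    (hf : Equivariant ρV ρW f) : Equivariant ρV ρX (g ∘ₗ f) := fun x => by
  rw [LinearMap.comp_assoc, hf x, ← LinearMap.comp_assoc, hg x, LinearMap.comp_assoc]

variable (ρV) in
theorem Equivariant.id : Equivariant ρV ρV LinearMap.id := fun _ => rfl

theorem Equivariant.map {f : V →ₗ[k] W} {g : X →ₗ[k] Y} (hf : Equivariant ρV ρW f)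
    (hg : Equivariant ρX ρY g) :
    Equivariant (ρV.tprod ρX) (ρW.tprod ρY) (TensorProduct.map f g) := fun x => by
  ext v w
  simp [hf.apply, hg.apply]

theorem Equivariant.rTensor {f : V →ₗ[k] W} (hf : Equivariant ρV ρW f) :
    Equivariant (ρV.tprod ρX) (ρW.tprod ρX) (f.rTensor X) := hf.map (.id ρX)

theorem Equivariant.lTensor {f : V →ₗ[k] W} (hf : Equivariant ρV ρW f) :
    Equivariant (ρX.tprod ρV) (ρX.tprod ρW) (f.lTensor X) := (Equivariant.id ρX).map hf

variable (ρV ρW ρX) in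
theorem equivariant_assoc : Equivariant ((ρV.tprod ρW).tprod ρX) (ρV.tprod (ρW.tprod ρX))
    (TensorProduct.assoc k V W X).toLinearMap := fun x => by
  ext a b c
  simp

theorem Equivariant.symm {f : V ≃ₗ[k] W} (hf : Equivariant ρV ρW f.toLinearMap) :
    Equivariant ρW ρV f.symm.toLinearMap := fun x => by
  ext w
  simp only [LinearMap.comp_apply, LinearEquiv.coe_coe]
  rw [LinearEquiv.symm_apply_eq]
  have := hf.apply x (f.symm w)
  rw [LinearEquiv.coe_coe, LinearEquiv.apply_symm_apply] at this
  exact this.symm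

variable (ρV ρW) in
theorem equivariant_comm : Equivariant (ρV.tprod ρW) (ρW.tprod ρV)
    (TensorProduct.comm k V W).toLinearMap := fun x => by
  ext a b
  simp

variable (ρV) in
theorem equivariant_lid : Equivariant ((Representation.trivial k (G := G) (V := k)).tprod ρV) ρV
    (TensorProduct.lid k V).toLinearMap := fun x => by
  ext a
  simp

variable (ρV) in
theorem equivariant_rid : Equivariant (ρV.tprod (Representation.trivial k (G := G) (V := k))) ρV
    (TensorProduct.rid k V).toLinearMap := fun x => by
  ext a
  simp

theorem Equivariant.of_generator [Finite G] {g : G} (hg : ∀ x, x ∈ Subgroup.zpowers g)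
    {f : V →ₗ[k] W} (hf : ∀ v, f (ρV g v) = ρW g (f v)) : Equivariant ρV ρW f := fun x => by
  obtain ⟨j, rfl⟩ := mem_powers_iff_mem_zpowers.2 (hg x)
  ext v
  change f (ρV (g ^ j) v) = ρW (g ^ j) (f v)
  induction j with
  | zero => simp
  | succ j ih => rw [pow_succ', rho_mul_apply, rho_mul_apply, hf, ih]

variable (ρV ρW) in
/-- Two maps are stably equal if their difference is stably trivial. -/
def StablyEqual (f f' : V →ₗ[k] W) : Prop := StablyTrivial ρV ρW (f - f')

theorem StablyEqual.comp_left {f f' : V →ₗ[k] W} (hf : StablyEqual ρV ρW f f') {g : W →ₗ[k] X}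
    (hg : Equivariant ρW ρX g) : StablyEqual ρV ρX (g ∘ₗ f) (g ∘ₗ f') := by
  obtain ⟨P, _, _, ρP, hP, a, b, ha, hb, h⟩ := hf
  refine ⟨P, _, _, ρP, hP, a, g ∘ₗ b, ha, hg.comp hb, ?_⟩
  rw [← LinearMap.comp_sub, h, LinearMap.comp_assoc]

theorem StablyEqual.comp_right {f f' : V →ₗ[k] W} (hf : StablyEqual ρV ρW f f') {g : X →ₗ[k] V}
    (hg : Equivariant ρX ρV g) : StablyEqual ρX ρW (f ∘ₗ g) (f' ∘ₗ g) := by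
  obtain ⟨P, _, _, ρP, hP, a, b, ha, hb, h⟩ := hf
  refine ⟨P, _, _, ρP, hP, a ∘ₗ g, b, ha.comp hg, hb, ?_⟩
  rw [← LinearMap.sub_comp, h, LinearMap.comp_assoc]

theorem StablyEqual.symm {f f' : V →ₗ[k] W} (hf : StablyEqual ρV ρW f f') :
    StablyEqual ρV ρW f' f := by
  obtain ⟨P, _, _, ρP, hP, a, b, ha, hb, h⟩ := hf
  refine ⟨P, _, _, ρP, hP, a, -b, ha, fun x => ?_, ?_⟩
  · rw [LinearMap.neg_comp, hb x, LinearMap.comp_neg]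
  · rw [LinearMap.neg_comp, ← h, neg_sub]

variable [Fintype G]

theorem StablyEqual.trans {f f' f'' : V →ₗ[k] W} (h : StablyEqual ρV ρW f f')
    (h' : StablyEqual ρV ρW f' f'') : StablyEqual ρV ρW f f'' := by
  obtain ⟨a, ha⟩ := h.exists_sum
  obtain ⟨b, hb⟩ := h'.exists_sum
  rw [StablyEqual, ← sub_add_sub_cancel f f' f'', ha, hb, ← sum_add_distrib]
  simp only [← LinearMap.comp_add, ← LinearMap.add_comp]
  exact stablyTrivial_sum (a + b)

instance : Trans (StablyEqual ρV ρW) (StablyEqual ρV ρW) (StablyEqual ρV ρW) where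
  trans := StablyEqual.trans

theorem StablyEqual.map_left {f f' : V →ₗ[k] W} (h : StablyEqual ρV ρW f f') {g : X →ₗ[k] Y}
    (hg : Equivariant ρX ρY g) :
    StablyEqual (ρV.tprod ρX) (ρW.tprod ρY) (TensorProduct.map f g) (TensorProduct.map f' g) := by
  obtain ⟨a, ha⟩ := h.exists_sum
  rw [StablyEqual]
  have : TensorProduct.map f g - TensorProduct.map f' g
      = ∑ x, (ρW.tprod ρY) x ∘ₗ TensorProduct.map a g ∘ₗ (ρV.tprod ρX) x⁻¹ := by
    ext v w
    have := LinearMap.congr_fun ha v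
    rw [LinearMap.sub_apply, LinearMap.sum_apply] at this
    simp [LinearMap.sum_apply, ← TensorProduct.sub_tmul, this, TensorProduct.sum_tmul, hg.apply,
      ← rho_mul_apply]
  rw [this]
  exact stablyTrivial_sum _

theorem StablyEqual.map_right {f f' : V →ₗ[k] W} (h : StablyEqual ρV ρW f f') {g : X →ₗ[k] Y}
    (hg : Equivariant ρX ρY g) :
    StablyEqual (ρX.tprod ρV) (ρY.tprod ρW) (TensorProduct.map g f) (TensorProduct.map g f') := by
  have key : ∀ f : V →ₗ[k] W, TensorProduct.map g f = (TensorProduct.comm k W Y).toLinearMap ∘ₗ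
      TensorProduct.map f g ∘ₗ (TensorProduct.comm k X V).toLinearMap := fun f => by
    ext v w
    simp
  rw [key, key]
  exact ((h.map_left hg).comp_right (equivariant_comm ρX ρV)).comp_left (equivariant_comm ρW ρY)

theorem StablyEqual.eq {p r : ℕ} [CharP k p] {g : G} (hg : ∀ x, x ∈ Subgroup.zpowers g)
    (hcard : Fintype.card G = p * r) (hV : ρV (g ^ r) = 1) (hW : ρW (g ^ r) = 1)
    {f f' : V →ₗ[k] W} (h : StablyEqual ρV ρW f f') : f = f' := by
  have h1 := (stablyTrivial_iff_isNorm hg).1 h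
  rw [hcard] at h1
  have h2 := h1.linearEquiv_pow
  rw [toLinearMap_pow] at h2
  have : ((((repEquiv ρV g).arrowCongr (repEquiv ρW g)).toLinearMap :
      Module.End k (V →ₗ[k] W)) ^ r) = 1 := by
    have hV' : ρV (g ^ r)⁻¹ = 1 := by
      rw [← mul_one (ρV (g ^ r)⁻¹), ← hV, ← map_mul, inv_mul_cancel, map_one, hV]
    ext1 f
    rw [arrowCongr_repEquiv_pow, hW, hV']
    rfl
  rw [this] at h2
  exact sub_eq_zero.1 (h2.eq_zero (CharP.cast_eq_zero k p))

end StablyEqual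

section Transport

variable {k G : Type} [Field k] [Group G] [Fintype G]
  {A : Type} [AddCommGroup A] [Module k A] {ρ : Representation k G A}
  {B : Type} [AddCommGroup B] [Module k B] {ρB : Representation k G B}

/-- A ring structure stably transported to a representation on which a subgroup of order `p`
acts trivially is a strict ring structure. -/
theorem StableTTRing.exists_strict (T : StableTTRing ρ) {p r : ℕ} [CharP k p] {g : G}
    (hg : ∀ x, x ∈ Subgroup.zpowers g) (hcard : Fintype.card G = p * r) (hB : ρB (g ^ r) = 1)
    {φ : B →ₗ[k] A} {ψ : A →ₗ[k] B} (hφ : Equivariant ρB ρ φ) (hψ : Equivariant ρ ρB ψ)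
    (hψφ : ψ ∘ₗ φ = LinearMap.id) (hφψ : StablyEqual ρ ρ (φ ∘ₗ ψ) LinearMap.id) :
    ∃ (μB : B ⊗[k] B →ₗ[k] B) (uB : k →ₗ[k] B) (σB : B →ₗ[k] B ⊗[k] B),
      Equivariant (ρB.tprod ρB) ρB μB ∧
      Equivariant (Representation.trivial k (G := G) (V := k)) ρB uB ∧
      Equivariant ρB (ρB.tprod ρB) σB ∧
      μB ∘ₗ μB.rTensor B =
        μB ∘ₗ μB.lTensor B ∘ₗ (TensorProduct.assoc k B B B).toLinearMap ∧
      μB ∘ₗ uB.rTensor B ∘ₗ (TensorProduct.lid k B).symm.toLinearMap = LinearMap.id ∧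
      μB ∘ₗ uB.lTensor B ∘ₗ (TensorProduct.rid k B).symm.toLinearMap = LinearMap.id ∧
      μB ∘ₗ (TensorProduct.comm k B B).toLinearMap = μB ∧
      μB ∘ₗ σB = LinearMap.id ∧
      μB.rTensor B ∘ₗ (TensorProduct.assoc k B B B).symm.toLinearMap ∘ₗ σB.lTensor B =
        σB ∘ₗ μB ∧
      μB.lTensor B ∘ₗ (TensorProduct.assoc k B B B).toLinearMap ∘ₗ σB.rTensor B =
        σB ∘ₗ μB ∧
      StablyEqual (ρB.tprod ρB) ρ (φ ∘ₗ μB) (T.mul ∘ₗ TensorProduct.map φ φ) ∧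
      StablyEqual (Representation.trivial k (G := G) (V := k)) ρ (φ ∘ₗ uB) T.one := by
  set μB : B ⊗[k] B →ₗ[k] B := ψ ∘ₗ T.mul ∘ₗ TensorProduct.map φ φ with hμB
  set uB : k →ₗ[k] B := ψ ∘ₗ T.one with huB
  set σB : B →ₗ[k] B ⊗[k] B := TensorProduct.map ψ ψ ∘ₗ T.sec ∘ₗ φ with hσB
  have hφφ := hφ.map hφ
  have hψψ := hψ.map hψ
  have eμ : Equivariant (ρB.tprod ρB) ρB μB := hψ.comp (T.mul_equivariant.comp hφφ)
  have eu : Equivariant (Representation.trivial k (G := G) (V := k)) ρB uB :=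
    hψ.comp T.one_equivariant
  have eσ : Equivariant ρB (ρB.tprod ρB) σB := hψψ.comp (T.sec_equivariant.comp hφ)
  have sμ : StablyEqual (ρB.tprod ρB) ρ (φ ∘ₗ μB) (T.mul ∘ₗ TensorProduct.map φ φ) :=
    hφψ.comp_right (T.mul_equivariant.comp hφφ)
  have su : StablyEqual (Representation.trivial k (G := G) (V := k)) ρ (φ ∘ₗ uB) T.one :=
    hφψ.comp_right T.one_equivariant
  have hφψ2 : StablyEqual (ρ.tprod ρ) (ρ.tprod ρ)
      (TensorProduct.map φ φ ∘ₗ TensorProduct.map ψ ψ) LinearMap.id := by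
    rw [← TensorProduct.map_comp, ← TensorProduct.map_id]
    exact (hφψ.map_left (hφ.comp hψ)).trans (hφψ.map_right (.id ρ))
  have sσ : StablyEqual ρB (ρ.tprod ρ) (TensorProduct.map φ φ ∘ₗ σB) (T.sec ∘ₗ φ) :=
    hφψ2.comp_right (T.sec_equivariant.comp hφ)
  have hψφ2 : TensorProduct.map ψ ψ ∘ₗ TensorProduct.map φ φ = LinearMap.id := by
    rw [← TensorProduct.map_comp, hψφ, TensorProduct.map_id]
  have hB2 : (ρB.tprod ρB) (g ^ r) = 1 := by
    rw [Representation.tprod_apply, hB]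
    exact TensorProduct.map_id
  have hB3 : ((ρB.tprod ρB).tprod ρB) (g ^ r) = 1 := by
    rw [Representation.tprod_apply, hB2, hB]
    exact TensorProduct.map_id
  have inj : ∀ {V : Type} [AddCommGroup V] [Module k V] {ρV : Representation k G V}
      {f f' : V →ₗ[k] B}, ρV (g ^ r) = 1 → StablyEqual ρV ρ (φ ∘ₗ f) (φ ∘ₗ f') → f = f' := by
    intro V _ _ ρV f f' hV h
    have := h.comp_left hψ
    rw [← LinearMap.comp_assoc, ← LinearMap.comp_assoc, hψφ, LinearMap.id_comp,
      LinearMap.id_comp] at this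
    exact this.eq hg hcard hV hB
  have inj2 : ∀ {f f' : B ⊗[k] B →ₗ[k] B ⊗[k] B},
      StablyEqual (ρB.tprod ρB) (ρ.tprod ρ) (TensorProduct.map φ φ ∘ₗ f)
        (TensorProduct.map φ φ ∘ₗ f') → f = f' := by
    intro f f' h
    have := h.comp_left hψψ
    rw [← LinearMap.comp_assoc, ← LinearMap.comp_assoc, hψφ2, LinearMap.id_comp,
      LinearMap.id_comp] at this
    exact this.eq hg hcard hB2 hB2
  clear_value μB uB σB
  have aB := equivariant_assoc ρB ρB ρB
  have lB := (equivariant_lid ρB).symm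
  have rB := (equivariant_rid ρB).symm
  refine ⟨μB, uB, σB, eμ, eu, eσ, inj hB3 ?_, inj hB ?_, inj hB ?_, inj hB2 ?_, inj hB ?_,
    inj2 ?_, inj2 ?_, sμ, su⟩
  · have h1 := sμ.comp_right (eμ.rTensor (ρX := ρB))
    have h2 := (sμ.map_left hφ).comp_left T.mul_equivariant
    have h3 := StablyEqual.comp_right T.assoc (hφφ.map hφ)
    have h4 := ((sμ.map_right hφ).comp_left T.mul_equivariant).comp_right aB
    have h5 := sμ.comp_right ((eμ.lTensor (ρX := ρB)).comp aB)
    calc StablyEqual ((ρB.tprod ρB).tprod ρB) ρ (φ ∘ₗ μB ∘ₗ μB.rTensor B) _ := h1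
      _ = T.mul ∘ₗ TensorProduct.map (φ ∘ₗ μB) φ := by ext; rfl
      StablyEqual _ _ _ _ := h2
      _ = (T.mul ∘ₗ T.mul.rTensor A) ∘ₗ TensorProduct.map (TensorProduct.map φ φ) φ := by
        ext; rfl
      StablyEqual _ _ _ _ := h3
      _ = (T.mul ∘ₗ TensorProduct.map φ (T.mul ∘ₗ TensorProduct.map φ φ)) ∘ₗ
          (TensorProduct.assoc k B B B).toLinearMap := by ext; rfl
      StablyEqual _ _ _ _ := h4.symm
      _ = (T.mul ∘ₗ TensorProduct.map φ φ) ∘ₗ μB.lTensor B ∘ₗ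
          (TensorProduct.assoc k B B B).toLinearMap := by ext; rfl
      StablyEqual _ _ _ _ := h5.symm
  · have h1 := sμ.comp_right ((eu.rTensor (ρX := ρB)).comp lB)
    have h2 := ((su.map_left hφ).comp_left T.mul_equivariant).comp_right lB
    have h3 := StablyEqual.comp_right T.one_mul hφ
    calc StablyEqual ρB ρ (φ ∘ₗ μB ∘ₗ uB.rTensor B ∘ₗ
          (TensorProduct.lid k B).symm.toLinearMap) _ := h1
      _ = (T.mul ∘ₗ TensorProduct.map (φ ∘ₗ uB) φ) ∘ₗ
          (TensorProduct.lid k B).symm.toLinearMap := by ext; rfl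
      StablyEqual _ _ _ _ := h2
      _ = (T.mul ∘ₗ T.one.rTensor A ∘ₗ (TensorProduct.lid k A).symm.toLinearMap) ∘ₗ φ := by
        ext; rfl
      StablyEqual _ _ _ _ := h3
  · have h1 := sμ.comp_right ((eu.lTensor (ρX := ρB)).comp rB)
    have h2 := ((su.map_right hφ).comp_left T.mul_equivariant).comp_right rB
    have h3 := StablyEqual.comp_right T.mul_one hφ
    calc StablyEqual ρB ρ (φ ∘ₗ μB ∘ₗ uB.lTensor B ∘ₗ
          (TensorProduct.rid k B).symm.toLinearMap) _ := h1
      _ = (T.mul ∘ₗ TensorProduct.map φ (φ ∘ₗ uB)) ∘ₗ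
          (TensorProduct.rid k B).symm.toLinearMap := by ext; rfl
      StablyEqual _ _ _ _ := h2
      _ = (T.mul ∘ₗ T.one.lTensor A ∘ₗ (TensorProduct.rid k A).symm.toLinearMap) ∘ₗ φ := by
        ext; rfl
      StablyEqual _ _ _ _ := h3
  · have h1 := sμ.comp_right (equivariant_comm ρB ρB)
    have h2 := StablyEqual.comp_right T.mul_comm hφφ
    calc StablyEqual (ρB.tprod ρB) ρ (φ ∘ₗ μB ∘ₗ (TensorProduct.comm k B B).toLinearMap) _ := h1
      _ = (T.mul ∘ₗ (TensorProduct.comm k A A).toLinearMap) ∘ₗ TensorProduct.map φ φ := by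
        ext; rfl
      StablyEqual _ _ _ _ := h2
      StablyEqual _ _ _ _ := sμ.symm
  · have h1 := sμ.comp_right eσ
    have h2 := sσ.comp_left T.mul_equivariant
    have h3 := StablyEqual.comp_right T.sep hφ
    calc StablyEqual ρB ρ (φ ∘ₗ μB ∘ₗ σB) _ := h1
      StablyEqual _ _ _ _ := h2
      StablyEqual _ _ _ _ := h3
  · have h1 := (sμ.map_left hφ).comp_right (aB.symm.comp (eσ.lTensor (ρX := ρB)))
    have h2 := (sσ.map_right hφ).comp_left
      (T.mul_equivariant.rTensor.comp (equivariant_assoc ρ ρ ρ).symm)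
    have h3 := StablyEqual.comp_right T.sec_left hφφ
    have h4 := sμ.comp_left T.sec_equivariant
    have h5 := sσ.comp_right eμ
    rw [← LinearMap.comp_assoc, LinearMap.map_comp_rTensor]
    calc StablyEqual (ρB.tprod ρB) (ρ.tprod ρ) (TensorProduct.map (φ ∘ₗ μB) φ ∘ₗ
          (TensorProduct.assoc k B B B).symm.toLinearMap ∘ₗ σB.lTensor B) _ := h1
      _ = (T.mul.rTensor A ∘ₗ (TensorProduct.assoc k A A A).symm.toLinearMap) ∘ₗ
          TensorProduct.map φ (TensorProduct.map φ φ ∘ₗ σB) := by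
        ext x y
        simp only [LinearMap.comp_apply, TensorProduct.AlgebraTensorModule.curry_apply,
          TensorProduct.curry_apply, LinearMap.restrictScalars_apply, LinearMap.lTensor_tmul,
          TensorProduct.map_tmul, LinearEquiv.coe_coe]
        generalize σB y = z
        induction z with
        | zero => simp
        | add z z' h h' => simp only [TensorProduct.tmul_add, map_add, h, h']
        | tmul y z => rfl
      StablyEqual _ _ _ _ := h2
      _ = (T.mul.rTensor A ∘ₗ (TensorProduct.assoc k A A A).symm.toLinearMap ∘ₗ
          T.sec.lTensor A) ∘ₗ TensorProduct.map φ φ := by ext; rfl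
      StablyEqual _ _ _ _ := h3
      StablyEqual _ _ _ _ := h4.symm
      StablyEqual _ _ _ _ := h5.symm
  · have h1 := (sμ.map_right hφ).comp_right (aB.comp (eσ.rTensor (ρX := ρB)))
    have h2 := (sσ.map_left hφ).comp_left
      (T.mul_equivariant.lTensor.comp (equivariant_assoc ρ ρ ρ))
    have h3 := StablyEqual.comp_right T.sec_right hφφ
    have h4 := sμ.comp_left T.sec_equivariant
    have h5 := sσ.comp_right eμ
    rw [← LinearMap.comp_assoc, LinearMap.map_comp_lTensor]
    calc StablyEqual (ρB.tprod ρB) (ρ.tprod ρ) (TensorProduct.map φ (φ ∘ₗ μB) ∘ₗ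
          (TensorProduct.assoc k B B B).toLinearMap ∘ₗ σB.rTensor B) _ := h1
      _ = (T.mul.lTensor A ∘ₗ (TensorProduct.assoc k A A A).toLinearMap) ∘ₗ
          TensorProduct.map (TensorProduct.map φ φ ∘ₗ σB) φ := by
        ext x y
        simp only [LinearMap.comp_apply, TensorProduct.AlgebraTensorModule.curry_apply,
          TensorProduct.curry_apply, LinearMap.restrictScalars_apply, LinearMap.rTensor_tmul,
          TensorProduct.map_tmul, LinearEquiv.coe_coe]
        generalize σB x = z
        induction z with
        | zero => simp
        | add z z' h h' => simp only [TensorProduct.add_tmul, map_add, h, h']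
        | tmul x z => rfl
      StablyEqual _ _ _ _ := h2
      _ = (T.mul.lTensor A ∘ₗ (TensorProduct.assoc k A A A).toLinearMap ∘ₗ
          T.sec.rTensor A) ∘ₗ TensorProduct.map φ φ := by ext; rfl
      StablyEqual _ _ _ _ := h3
      StablyEqual _ _ _ _ := h4.symm
      StablyEqual _ _ _ _ := h5.symm

end Transport

end Auxiliary

/-- Every stable tt-ring over a cyclic `p`-group is stably isomorphic (as a ring in
the stable category) to a genuine commutative separable ring-object of the ordinary
module category, i.e. one whose axioms hold strictly. -/
theorem stable_tt_ring_over_cyclic_p_group_lifts_to_module_category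
    (p n : ℕ) (hp : p.Prime) (hn : 1 ≤ n)
    (k : Type) [Field k] [CharP k p]
    (G : Type) [Group G] [Fintype G] (hcyc : IsCyclic G) (hcard : Fintype.card G = p ^ n)
    (A : Type) [AddCommGroup A] [Module k A] [FiniteDimensional k A]
    (ρ : Representation k G A) (T : StableTTRing ρ) :
    ∃ (B : Type) (_ : AddCommGroup B) (_ : Module k B)
      (_ : FiniteDimensional k B) (ρB : Representation k G B)
      (μB : B ⊗[k] B →ₗ[k] B) (uB : k →ₗ[k] B) (σB : B →ₗ[k] B ⊗[k] B),
      Equivariant (ρB.tprod ρB) ρB μB ∧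
      Equivariant (Representation.trivial k (G := G) (V := k)) ρB uB ∧
      Equivariant ρB (ρB.tprod ρB) σB ∧
      μB ∘ₗ μB.rTensor B =
        μB ∘ₗ μB.lTensor B ∘ₗ (TensorProduct.assoc k B B B).toLinearMap ∧
      μB ∘ₗ uB.rTensor B ∘ₗ (TensorProduct.lid k B).symm.toLinearMap = LinearMap.id ∧
      μB ∘ₗ uB.lTensor B ∘ₗ (TensorProduct.rid k B).symm.toLinearMap = LinearMap.id ∧
      μB ∘ₗ (TensorProduct.comm k B B).toLinearMap = μB ∧
      μB ∘ₗ σB = LinearMap.id ∧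
      μB.rTensor B ∘ₗ (TensorProduct.assoc k B B B).symm.toLinearMap ∘ₗ σB.lTensor B =
        σB ∘ₗ μB ∧
      μB.lTensor B ∘ₗ (TensorProduct.assoc k B B B).toLinearMap ∘ₗ σB.rTensor B =
        σB ∘ₗ μB ∧
      ∃ φ : B →ₗ[k] A,
        StableIso ρB ρ φ ∧
        StablyTrivial (ρB.tprod ρB) ρ (φ ∘ₗ μB - T.mul ∘ₗ TensorProduct.map φ φ) ∧
        StablyTrivial (Representation.trivial k (G := G) (V := k)) ρ
          (φ ∘ₗ uB - T.one) := by
  have : Fact p.Prime := ⟨hp⟩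
  obtain ⟨r', rfl⟩ : ∃ r', n = r' + 1 := ⟨n - 1, by omega⟩
  obtain ⟨g, hg⟩ := hcyc.exists_generator
  have hpow : ∀ j x, ((repEquiv ρ g) ^ j) x = ρ (g ^ j) x := fun j x => by
    induction j with
    | zero => simp
    | succ j ih =>
      rw [pow_succ', LinearEquiv.mul_apply, ih, repEquiv_apply, pow_succ', rho_mul_apply]
  have hγ : (repEquiv ρ g) ^ p ^ (r' + 1) = 1 := by
    ext x
    rw [hpow, ← hcard, pow_card_eq_one, map_one]
    rfl
  have R := T.isNormRing hg
  rw [hcard] at R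
  obtain ⟨P, hPfix, hPP, hPnorm, hPker⟩ :=
    exists_norm_idempotent hγ fun x hx hxs => R.mem_range_norm hγ hx hxs
  have hP : Equivariant ρ ρ P := .of_generator hg fun v => by
    conv_lhs => rw [← mem_conjFixed.1 hPfix, LinearEquiv.conj_apply_apply, ← repEquiv_apply,
      LinearEquiv.symm_apply_apply]
    rfl
  have hinv : ∀ x, LinearMap.ker P ≤ (LinearMap.ker P).comap (ρ x) := fun x v hv => by
    rw [Submodule.mem_comap, LinearMap.mem_ker, hP.apply, LinearMap.mem_ker.1 hv, map_zero]
  let ρB : Representation k G (LinearMap.ker P) := ρ.subrepresentation (LinearMap.ker P) hinv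
  let φ : LinearMap.ker P →ₗ[k] A := (LinearMap.ker P).subtype
  let ψ : A →ₗ[k] LinearMap.ker P := (LinearMap.id - P).codRestrict (LinearMap.ker P) fun x => by
    have := LinearMap.congr_fun hPP x
    rw [Module.End.mul_apply] at this
    rw [LinearMap.mem_ker, LinearMap.sub_apply, LinearMap.id_apply, map_sub, this, sub_self]
  have hφ : Equivariant ρB ρ φ := fun _ => rfl
  have hψ : Equivariant ρ ρB ψ := fun x => by
    ext v
    change ρ x v - P (ρ x v) = ρ x (v - P v)
    rw [map_sub, hP.apply]
  have hψφ : ψ ∘ₗ φ = LinearMap.id := by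
    ext v
    change (v : A) - P v = v
    rw [LinearMap.mem_ker.1 v.2, sub_zero]
  have hφψ : StablyEqual ρ ρ (φ ∘ₗ ψ) LinearMap.id := by
    have h : φ ∘ₗ ψ - LinearMap.id = -P := by
      ext v
      change v - P v - v = - P v
      abel
    rw [StablyEqual, h, stablyTrivial_iff_isNorm hg, hcard]
    exact IsNorm.neg hPnorm
  have hB : ρB (g ^ p ^ r') = 1 := by
    ext v
    exact (hpow _ _).symm.trans (hPker v v.2)
  obtain ⟨μB, uB, σB, h1, h2, h3, h4, h5, h6, h7, h8, h9, h10, h11, h12⟩ :=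
    T.exists_strict hg (hcard.trans (pow_succ' p r')) hB hφ hψ hψφ hφψ
  refine ⟨LinearMap.ker P, inferInstance, inferInstance, inferInstance, ρB, μB, uB, σB,
    h1, h2, h3, h4, h5, h6, h7, h8, h9, h10, φ, ⟨hφ, ψ, hψ, ?_, hφψ⟩, h11, h12⟩
  rw [hψφ, sub_self, stablyTrivial_iff_isNorm hg]
  exact IsNorm.zero _ _
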